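/- arXiv:1608.02022 — 4 statements merged into one kernel-verified Lean document; each statement's English description precedes it below -/
import Mathlib

section
/- The set of all sums p₅(x₁) + p₅(x₂) + p₅(x₃) + 3·p₅(x₄) with x₁, x₂, x₃, x₄ nonnegative integers equals the set of all nonnegative integers except 19. -/
def pent (x : ℕ) : ℕ := x * (3 * x - 1) / 2

def orShift (T c : ℕ) : ℕ → ℕ
  | 0 => 0
  | k + 1 => orShift T c k ||| (T <<< (c * pent k))

theorem orShift_spec (T c k n : ℕ) (h : (orShift T c k).testBit n = true) :
    ∃ i, c * pent i ≤ n ∧ T.testBit (n - c * pent i) = true := by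
  induction k with
  | zero => simp [orShift] at h
  | succ k ih =>
    simp only [orShift, Nat.testBit_or, Bool.or_eq_true, Nat.testBit_shiftLeft, Bool.and_eq_true, decide_eq_true_eq] at h
    rcases h with h | ⟨h1, h2⟩
    · exact ih h
    · exact ⟨k, h1, h2⟩

/-- `force n f = f n`, but kernel evaluation computes `n` first. -/
def force (n : ℕ) (f : ℕ → Bool) : Bool :=
  Nat.rec (f 0) (fun k _ => f (k + 1)) n

theorem force_eq (n : ℕ) (f : ℕ → Bool) : force n f = f n := by
  cases n <;> rfl

theorem small_aux : (force (orShift 1 1 170) fun T₁ => force (orShift T₁ 1 170) fun T₂ =>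
    force (orShift T₂ 1 170) fun T₃ => force (orShift T₃ 3 100) fun T₄ =>
    Nat.beq ((T₄ ||| 2 ^ 19) % 2 ^ 42000) (2 ^ 42000 - 1)) = true := by
  decide +kernel

theorem small (n : ℕ) (hn : n < 42000) (h19 : n ≠ 19) :
    ∃ x₁ x₂ x₃ x₄ : ℕ, n = pent x₁ + pent x₂ + pent x₃ + 3 * pent x₄ := by
  have h0 := small_aux
  rw [force_eq, force_eq, force_eq, force_eq] at h0
  have h := congrArg (fun t => Nat.testBit t n) (Nat.eq_of_beq_eq_true h0)
  simp only [Nat.testBit_mod_two_pow, Nat.testBit_two_pow_sub_one, hn, decide_true, Bool.true_and,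
    Nat.testBit_or, Nat.testBit_two_pow, Bool.or_eq_true, decide_eq_true_eq] at h
  rcases h with h | h
  · obtain ⟨d, hd, h⟩ := orShift_spec _ _ _ _ h
    obtain ⟨c, hc, h⟩ := orShift_spec _ _ _ _ h
    obtain ⟨b, hb, h⟩ := orShift_spec _ _ _ _ h
    obtain ⟨a, ha, h⟩ := orShift_spec _ _ _ _ h
    rw [Nat.testBit_one_eq_true_iff_self_eq_zero] at h
    exact ⟨a, b, c, d, by omega⟩
  · exact absurd h.symm h19

theorem no19 (a b c d : ℕ) : 19 ≠ pent a + pent b + pent c + 3 * pent d := by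
  intro h
  have key : ∀ x : ℕ, 4 ≤ x → 20 ≤ pent x := by
    intro x hx
    unfold pent
    rw [Nat.le_div_iff_mul_le (by norm_num)]
    calc 20 * 2 ≤ 4 * 11 := by norm_num
      _ ≤ x * (3 * x - 1) := Nat.mul_le_mul hx (by omega)
  have k : ∀ x, pent x ≤ 19 → x < 4 := by
    intro x hx
    by_contra h
    have := key x (by omega)
    omega
  have ha := k a (by omega)
  have hb := k b (by omega)
  have hc := k c (by omega)
  have hd := k d (by omega)
  interval_cases a <;> interval_cases b <;> interval_cases c <;> interval_cases d <;> simp [pent] at h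
theorem tern_final (N : ℤ) (hN : N % 8 = 5) (B C H T y z : ℤ) (hB : 0 < B) (hB2 : B ≤ 2)
    (hH1 : -B ≤ 2 * H) (hH2 : 2 * H ≤ B) (hdet : B * C - H ^ 2 = 3)
    (hfx : T ^ 2 + B * y ^ 2 + 2 * H * (y * z) + C * z ^ 2 = N) :
    ∃ X Y Z : ℤ, X ^ 2 + Y ^ 2 + 3 * Z ^ 2 = N := by
  have hB12 : B = 1 ∨ B = 2 := by omega
  rcases hB12 with rfl | rfl
  · have : H = 0 := by omega
    subst this
    have : C = 3 := by linarith
    subst this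
    exact ⟨T, y, z, by linarith [hfx]⟩
  · exfalso
    have hH : H = -1 ∨ H = 0 ∨ H = 1 := by omega
    have key : ∀ X Y Z : ZMod 8, X ^ 2 + 2 * Y ^ 2 + 2 * (Y * Z) + 2 * Z ^ 2 ≠ 5 ∧ X ^ 2 + 2 * Y ^ 2 - 2 * (Y * Z) + 2 * Z ^ 2 ≠ 5 := by decide
    have hN5 : (N : ZMod 8) = 5 := by
      have : ((N : ℤ) : ZMod 8) = ((5 : ℤ) : ZMod 8) := by
        rw [ZMod.intCast_eq_intCast_iff]; exact hN
      simpa using this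
    have k := key (T : ZMod 8) (y : ZMod 8) (z : ZMod 8)
    rcases hH with rfl | rfl | rfl
    · have : C = 2 := by linarith
      subst this
      apply k.2
      rw [← hN5, ← hfx]; push_cast; ring
    · omega
    · have : C = 2 := by linarith
      subst this
      apply k.1
      rw [← hN5, ← hfx]; push_cast; ring

set_option maxHeartbeats 1600000 in
theorem ternary_red (N : ℤ) (hN : N % 8 = 5) (k : ℕ) : ∀ a b c d e f : ℤ, 0 < a → 0 < a * b - f ^ 2 →
    a * b * c + 2 * d * e * f - a * d ^ 2 - b * e ^ 2 - c * f ^ 2 = 3 →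
    (a + (a * b - f ^ 2)).toNat ≤ k →
    (∃ x y z : ℤ, a * x ^ 2 + b * y ^ 2 + c * z ^ 2 + 2 * d * (y * z) + 2 * e * (x * z) + 2 * f * (x * y) = N) →
    ∃ X Y Z : ℤ, X ^ 2 + Y ^ 2 + 3 * Z ^ 2 = N := by
  induction k with
  | zero => intro a b c d e f ha hB _ hk; omega
  | succ k ih =>
    intro a b c d e f ha hB hD hk hx
    -- shift y by multiple of z
    have hround : ∀ u v : ℤ, 0 < v → ∃ t : ℤ, -v ≤ 2 * (u + t * v) ∧ 2 * (u + t * v) ≤ v := by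
      intro u v hv
      refine ⟨-((2 * u + v) / (2 * v)), ?_, ?_⟩
      · have := Int.ediv_mul_le (2 * u + v) (b := 2 * v) (by omega)
        nlinarith
      · have := Int.lt_ediv_add_one_mul_self (2 * u + v) (b := 2 * v) (by omega)
        nlinarith
    -- first normalise f: x → x + t y
    obtain ⟨b, d, f, hB, hD, hk, hx, hf1, hf2⟩ : ∃ b d f : ℤ, 0 < a * b - f ^ 2 ∧
        a * b * c + 2 * d * e * f - a * d ^ 2 - b * e ^ 2 - c * f ^ 2 = 3 ∧
        (a + (a * b - f ^ 2)).toNat ≤ k + 1 ∧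
        (∃ x y z : ℤ, a * x ^ 2 + b * y ^ 2 + c * z ^ 2 + 2 * d * (y * z) + 2 * e * (x * z) + 2 * f * (x * y) = N) ∧
        -a ≤ 2 * f ∧ 2 * f ≤ a := by
      obtain ⟨t, h1, h2⟩ := hround f a ha
      have e1 : a * (b + 2 * f * t + a * t ^ 2) - (f + t * a) ^ 2 = a * b - f ^ 2 := by ring
      refine ⟨b + 2 * f * t + a * t ^ 2, d + t * e, f + t * a, by rw [e1]; exact hB, ?_,
        by rw [e1]; exact hk, ?_, h1, h2⟩
      · rw [← hD]; ring
      · obtain ⟨x, y, z, h⟩ := hx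
        exact ⟨x - t * y, y, z, by rw [← h]; ring⟩
    obtain ⟨c, d, e, hD, hx, hH1, hH2⟩ : ∃ c d e : ℤ,
        a * b * c + 2 * d * e * f - a * d ^ 2 - b * e ^ 2 - c * f ^ 2 = 3 ∧
        (∃ x y z : ℤ, a * x ^ 2 + b * y ^ 2 + c * z ^ 2 + 2 * d * (y * z) + 2 * e * (x * z) + 2 * f * (x * y) = N) ∧
        -(a * b - f ^ 2) ≤ 2 * (a * d - e * f) ∧ 2 * (a * d - e * f) ≤ a * b - f ^ 2 := by
      obtain ⟨t, h1, h2⟩ := hround (a * d - e * f) (a * b - f ^ 2) hB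
      have e1 : a * (d + t * b) - (e + t * f) * f = a * d - e * f + t * (a * b - f ^ 2) := by ring
      refine ⟨c + 2 * d * t + b * t ^ 2, d + t * b, e + t * f, ?_, ?_, by rw [e1]; exact h1, by rw [e1]; exact h2⟩
      · rw [← hD]; ring
      · obtain ⟨x, y, z, h⟩ := hx
        exact ⟨x, y - t * z, z, by rw [← h]; ring⟩
    obtain ⟨x, y, z, hx⟩ := hx
    have hdet : (a * b - f ^ 2) * (a * c - e ^ 2) - (a * d - e * f) ^ 2 = 3 * a := by
      rw [← hD]; ring
    have hfx : (a * x + f * y + e * z) ^ 2 + (a * b - f ^ 2) * y ^ 2 + 2 * (a * d - e * f) * (y * z)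
        + (a * c - e ^ 2) * z ^ 2 = a * N := by
      rw [← hx]; ring
    by_cases hba : b < a
    · have hb : 0 < b := by
        by_contra hb
        nlinarith [sq_nonneg f]
      exact ih b a c e d f hb (by linarith) (by rw [← hD]; ring) (by
        have : b * a = a * b := mul_comm _ _
        omega) ⟨y, x, z, by rw [← hx]; ring⟩
    have hC : 0 < a * c - e ^ 2 := by
      by_contra hC
      nlinarith [sq_nonneg (a * d - e * f)]
    by_cases hCB : a * c - e ^ 2 < a * b - f ^ 2
    · exact ih a c b d f e ha hC (by rw [← hD]; ring) (by omega) ⟨x, z, y, by rw [← hx]; ring⟩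
    clear ih hk
    have hf4 : 4 * f ^ 2 ≤ a ^ 2 := by nlinarith
    have hab : a * a ≤ a * b := mul_le_mul_of_nonneg_left (not_lt.mp hba) ha.le
    have hBa : 3 * a ^ 2 ≤ 4 * (a * b - f ^ 2) := by linarith
    generalize hBe : a * b - f ^ 2 = B at *
    generalize hCe : a * c - e ^ 2 = C at *
    generalize hHe : a * d - e * f = H at *
    have hBB : B ^ 2 ≤ 4 * a := by
      have h1 : 4 * H ^ 2 ≤ B ^ 2 := by nlinarith only [hH1, hH2]
      have h2 : B * B ≤ B * C := mul_le_mul_of_nonneg_left (not_lt.mp hCB) (by linarith only [hH1, hH2])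
      linarith
    have ha1 : a = 1 := by
      by_contra hne
      have h2 : 2 ≤ a := lt_of_le_of_ne ha (Ne.symm hne)
      have h3 : 2 * a ≤ a ^ 2 := by nlinarith only [h2]
      have h4 : 3 * a ≤ 2 * B := by linarith
      nlinarith only [h4, hBB, h2]
    subst ha1
    have hB2 : B ≤ 2 := by nlinarith only [hBB, hB]
    exact tern_final N hN B C H (1 * x + f * y + e * z) y z (by linarith only [hBa]) hB2 hH1 hH2 (by linarith only [hdet]) (by linarith only [hfx])

theorem pent_toNat (x : ℤ) (hx : 0 ≤ x) : 2 * (pent x.toNat : ℤ) = 3 * x ^ 2 - x := by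
  obtain ⟨k, rfl⟩ := Int.eq_ofNat_of_zero_le hx
  have h2 : 2 ∣ k * (3 * k - 1) := by
    rcases Nat.even_or_odd k with h | h
    · exact Dvd.dvd.mul_right h.two_dvd _
    · exact Dvd.dvd.mul_left (by obtain ⟨j, rfl⟩ := h; omega) _
  simp only [pent, Int.toNat_natCast]
  have : 2 * (k * (3 * k - 1) / 2) = k * (3 * k - 1) := Nat.mul_div_cancel' h2
  have h3 : ((2 * (k * (3 * k - 1) / 2) : ℕ) : ℤ) = ((k * (3 * k - 1) : ℕ) : ℤ) := by rw [this]
  rcases Nat.eq_zero_or_pos k with rfl | hk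
  · simp
  · rw [Nat.cast_mul k, Nat.cast_sub (by omega)] at h3
    push_cast at h3 ⊢
    rw [h3]; ring

theorem nonneg_aux (a b x y z w : ℤ) (hb : 0 ≤ b) (ha : x ^ 2 + y ^ 2 + z ^ 2 + 3 * w ^ 2 = a)
    (hs : x + y + z + 3 * w = b) (h : 5 * a < b ^ 2 + 2 * b + 6) : 0 ≤ x := by
  by_contra hx
  have hc : (y + z + 3 * w) ^ 2 ≤ 5 * (y ^ 2 + z ^ 2 + 3 * w ^ 2) := by
    nlinarith [sq_nonneg (y - z), sq_nonneg (y - w), sq_nonneg (z - w)]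
  have e : y + z + 3 * w = b - x := by linarith
  rw [e] at hc
  nlinarith

theorem nonneg_auxw (a b x y z w : ℤ) (hb : 0 ≤ b) (ha : x ^ 2 + y ^ 2 + z ^ 2 + 3 * w ^ 2 = a)
    (hs : x + y + z + 3 * w = b) (h : 5 * a < b ^ 2 + 2 * b + 6) : 0 ≤ w := by
  by_contra hx
  have hc : (x + y + z) ^ 2 ≤ 3 * (x ^ 2 + y ^ 2 + z ^ 2) := by
    nlinarith [sq_nonneg (y - z), sq_nonneg (y - x), sq_nonneg (z - x)]
  have e : x + y + z = b - 3 * w := by linarith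
  rw [e] at hc
  nlinarith

theorem arrange (b X Y Z N : ℤ) (h : X ^ 2 + Y ^ 2 + 3 * Z ^ 2 = N) (hN : N % 4 = 1) (hb : b % 2 = 1)
    (h3 : (N + b ^ 2) % 3 = 0) :
    ∃ X Y Z : ℤ, X ^ 2 + Y ^ 2 + 3 * Z ^ 2 = N ∧ (X - b) % 6 = 0 ∧ (Y - b) % 3 = 0 ∧ (Y - Z) % 2 = 0 := by
  have sq4 : ∀ t : ℤ, (t % 2 = 0 ∧ t ^ 2 % 4 = 0) ∨ (t % 2 = 1 ∧ t ^ 2 % 4 = 1) := by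
    intro t
    have : t % 4 = 0 ∨ t % 4 = 1 ∨ t % 4 = 2 ∨ t % 4 = 3 := by omega
    rcases this with h | h | h | h <;> [left; right; left; right] <;>
      exact ⟨by omega, by rw [pow_two, Int.mul_emod, h]; rfl⟩
  have sq3 : ∀ t : ℤ, (t % 3 = 0 ∧ t ^ 2 % 3 = 0) ∨ (t % 3 = 1 ∧ t ^ 2 % 3 = 1) ∨ (t % 3 = 2 ∧ t ^ 2 % 3 = 1) := by
    intro t
    have : t % 3 = 0 ∨ t % 3 = 1 ∨ t % 3 = 2 := by omega
    rcases this with h | h | h <;> [left; (right; left); (right; right)] <;>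
      exact ⟨by omega, by rw [pow_two, Int.mul_emod, h]; rfl⟩
  -- swap
  obtain ⟨X, Y, h, hX, hYZ⟩ : ∃ X Y : ℤ, X ^ 2 + Y ^ 2 + 3 * Z ^ 2 = N ∧ X % 2 = 1 ∧ (Y - Z) % 2 = 0 := by
    have hX := sq4 X
    have hY := sq4 Y
    have hZ := sq4 Z
    by_cases hx : X % 2 = 1
    · exact ⟨X, Y, h, hx, by omega⟩
    · exact ⟨Y, X, by linarith, by omega, by omega⟩
  have hX3 := sq3 X
  have hY3 := sq3 Y
  have hb3 := sq3 b
  obtain ⟨X2, hX2, hx⟩ : ∃ X2, X2 ^ 2 = X ^ 2 ∧ (X2 - b) % 6 = 0 := by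
    by_cases hx : (X - b) % 3 = 0
    · exact ⟨X, rfl, by omega⟩
    · exact ⟨-X, by ring, by omega⟩
  obtain ⟨Y2, hY2, hy, hy2⟩ : ∃ Y2, Y2 ^ 2 = Y ^ 2 ∧ (Y2 - b) % 3 = 0 ∧ (Y2 - Z) % 2 = 0 := by
    by_cases hx : (Y - b) % 3 = 0
    · exact ⟨Y, rfl, by omega, by omega⟩
    · exact ⟨-Y, by ring, by omega, by omega⟩
  exact ⟨X2, Y2, Z, by rw [hX2, hY2, h], hx, hy, hy2⟩

theorem finish (n : ℕ) (m X Y Z : ℤ) (hm : 0 ≤ m) (hbig : 5 * (n : ℤ) < 6 * m ^ 2 + 7 * m + 11)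
    (hmod : (2 * m + 1 - n) % 3 = 0) (h : X ^ 2 + Y ^ 2 + 3 * Z ^ 2 = 4 * (n - m ^ 2) + 1) :
    ∃ x₁ x₂ x₃ x₄ : ℕ, n = pent x₁ + pent x₂ + pent x₃ + 3 * pent x₄ := by
  obtain ⟨X, Y, Z, h, hX, hY, hYZ⟩ := arrange (2 * m + 1) X Y Z _ h (by omega) (by omega) (by
    have : 4 * (n - m ^ 2) + 1 + (2 * m + 1) ^ 2 = 4 * n + 4 * m + 2 := by ring
    rw [this]; omega)
  obtain ⟨w, hw⟩ : ∃ w, w = (2 * m + 1 - X) / 6 := ⟨_, rfl⟩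
  obtain ⟨z, hz⟩ : ∃ z, z = (2 * m + 1 - 3 * w - Y) / 3 := ⟨_, rfl⟩
  obtain ⟨x, hx⟩ : ∃ x, x = (2 * m + 1 - 3 * w - z + Z) / 2 := ⟨_, rfl⟩
  obtain ⟨y, hy⟩ : ∃ y, y = 2 * m + 1 - 3 * w - z - x := ⟨_, rfl⟩
  have eX : X = 2 * m + 1 - 6 * w := by omega
  have eY : Y = 2 * m + 1 - 3 * w - 3 * z := by omega
  have eZ : Z = x - y := by omega
  have em : 2 * m + 1 = x + y + z + 3 * w := by omega
  obtain ⟨b, hb⟩ : ∃ b, b = 2 * m + 1 := ⟨_, rfl⟩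
  obtain ⟨a, ha⟩ : ∃ a, a = x ^ 2 + y ^ 2 + z ^ 2 + 3 * w ^ 2 := ⟨_, rfl⟩
  have e1 : 4 * ((n:ℤ) - m ^ 2) + 1 = 4 * n + 2 * b - b ^ 2 := by rw [hb]; ring
  have e2 : X ^ 2 + Y ^ 2 + 3 * Z ^ 2 = 6 * a - b ^ 2 := by
    rw [ha, eX, eY, eZ, hb, em]; ring
  have h3a : 3 * a = 2 * n + b := by linarith
  have hlt : 5 * a < b ^ 2 + 2 * b + 6 := by
    have : b ^ 2 = 4 * m ^ 2 + 4 * m + 1 := by rw [hb]; ring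
    omega
  have hb0 : 0 ≤ b := by omega
  have hx0 := nonneg_aux a b x y z w hb0 (by linarith) (by linarith) hlt
  have hy0 := nonneg_aux a b y x z w hb0 (by linarith) (by linarith) hlt
  have hz0 := nonneg_aux a b z x y w hb0 (by linarith) (by linarith) hlt
  have hw0 := nonneg_auxw a b x y z w hb0 (by linarith) (by linarith) hlt
  refine ⟨x.toNat, y.toNat, z.toNat, w.toNat, ?_⟩
  have p1 := pent_toNat x hx0
  have p2 := pent_toNat y hy0
  have p3 := pent_toNat z hz0
  have p4 := pent_toNat w hw0
  zify
  linarith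

theorem choose_m (n r : ℕ) (hn : 42000 ≤ n) (hr : r < 18) :
    ∃ m : ℕ, m % 18 = r ∧ m ^ 2 ≤ n ∧ 5 * n < 6 * m ^ 2 + 7 * m + 11 := by
  have h1 := Nat.sqrt_le' n
  have h2 := Nat.lt_succ_sqrt' n
  have h3 : 204 ≤ Nat.sqrt n := by rw [Nat.le_sqrt]; omega
  generalize Nat.sqrt n = s at *
  obtain ⟨m, hm, hm1, hm2⟩ : ∃ m, m % 18 = r ∧ m ≤ s ∧ s ≤ m + 17 :=
    ⟨s - (s + 18 - r) % 18, by omega, by omega, by omega⟩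
  refine ⟨m, hm, le_trans (Nat.pow_le_pow_left hm1 2) h1, ?_⟩
  have : (s + 1) ^ 2 ≤ (m + 18) ^ 2 := Nat.pow_le_pow_left (by omega) 2
  simp only [Nat.succ_eq_add_one] at h2
  have hm3 : 187 ≤ m := by omega
  nlinarith

open NumberTheorySymbols in
theorem sym_aux (e p : ℕ) [Fact p.Prime] (he : e % 12 = 5) (hp8 : p % 8 = 7) (hpe : J((p : ℤ) | e) = -1) :
    ∃ A f : ℤ, 0 < A ∧ A * p - f ^ 2 = 2 * e := by
  have hpo : Odd p := Nat.odd_iff.mpr (by omega)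
  have h2 : J(-2 | p) = -1 := by
    rw [jacobiSym.at_neg_two hpo]
    have : ((p : ℕ) : ZMod 8) = ((7 : ℕ) : ZMod 8) := by
      rw [ZMod.natCast_eq_natCast_iff]; exact hp8
    rw [this]; decide
  have h1 : J(-2 * e | p) = 1 := by
    rw [jacobiSym.mul_left, h2, jacobiSym.quadratic_reciprocity_one_mod_four (by omega) hpo, hpe]
    norm_num
  obtain ⟨r, hr⟩ := ZMod.isSquare_of_jacobiSym_eq_one h1
  obtain ⟨f, rfl⟩ := ZMod.intCast_surjective r
  have : ((f ^ 2 + 2 * e : ℤ) : ZMod p) = 0 := by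
    push_cast at hr ⊢
    rw [pow_two, ← hr]; ring
  rw [ZMod.intCast_zmod_eq_zero_iff_dvd] at this
  obtain ⟨A, hA⟩ := this
  refine ⟨A, f, ?_, by linarith⟩
  have hp0 : (0 : ℤ) < p := by omega
  have he0 : (0 : ℤ) < e := by omega
  by_contra hA0
  nlinarith [sq_nonneg f]

open NumberTheorySymbols in
theorem sym_three (e : ℕ) (he : e % 12 = 5) : J(3 | e) = -1 ∧ J(-1 | e) = 1 := by
  have heo : Odd e := Nat.odd_iff.mpr (by omega)
  constructor
  · have := jacobiSym.quadratic_reciprocity_one_mod_four' (a := 3) (b := e) (by decide) (by omega)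
    push_cast at this
    rw [this, jacobiSym.mod_left]
    have h : (e : ℤ) % (3 : ℕ) = 2 := by push_cast; omega
    rw [h]
    norm_num
  · rw [jacobiSym.at_neg_one heo]
    exact ZMod.χ₄_nat_one_mod_four (by omega)

theorem tern_case1 (N : ℕ) (h8 : N % 8 = 5) (h3 : N % 3 = 2) :
    ∃ X Y Z : ℤ, X ^ 2 + Y ^ 2 + 3 * Z ^ 2 = N := by
  have hcop : (10 * N - 3).Coprime (24 * N) := by
    apply Nat.Coprime.mul_right
    · have h2 : (10 * N - 3).Coprime 2 := by
        rw [Nat.coprime_comm, Nat.Prime.coprime_iff_not_dvd Nat.prime_two]; omega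
      have h3 : (10 * N - 3).Coprime 3 := by
        rw [Nat.coprime_comm, Nat.Prime.coprime_iff_not_dvd Nat.prime_three]; omega
      exact Nat.Coprime.mul_right (Nat.Coprime.pow_right 3 h2) h3
    · have hN3 : Nat.Coprime 3 N := by
        rw [Nat.Prime.coprime_iff_not_dvd Nat.prime_three]; omega
      have : Nat.gcd (10 * N - 3) N ∣ 3 := by
        have h1 := Nat.gcd_dvd_left (10 * N - 3) N
        have h2 := (Nat.gcd_dvd_right (10 * N - 3) N).mul_left 10
        have := Nat.dvd_sub h2 h1
        rwa [show 10 * N - (10 * N - 3) = 3 by omega] at this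
      exact Nat.eq_one_of_dvd_coprimes hN3 this (Nat.gcd_dvd_right _ _)
  obtain ⟨p, hgt, hp, hmod⟩ := Nat.forall_exists_prime_gt_and_modEq (10 * N) (by omega) hcop
  obtain ⟨k, hk⟩ := (Nat.modEq_iff_dvd' (by omega)).mp hmod.symm
  have : Fact p.Prime := ⟨hp⟩
  obtain ⟨e, he⟩ : ∃ e, e = 12 * k + 5 := ⟨_, rfl⟩
  have hpe : p + 3 = 2 * e * N := by
    have : p = 24 * N * k + (10 * N - 3) := by omega
    have h3 : p + 3 = 24 * N * k + 10 * N := by omega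
    rw [h3, he]; ring
  have hpez : (p : ℤ) = 2 * e * N - 3 := by
    have : ((p + 3 : ℕ) : ℤ) = ((2 * e * N : ℕ) : ℤ) := by rw [hpe]
    push_cast at this; linarith
  have hp8 : p % 8 = 7 := by
    have h1 : (e * N) % 4 = 1 := by rw [Nat.mul_mod, show e % 4 = 1 by omega, show N % 4 = 1 by omega]
    rw [mul_assoc] at hpe
    omega
  have he12 : e % 12 = 5 := by omega
  obtain ⟨A, f, hA, hAf⟩ := sym_aux e p he12 hp8 (by
    have : jacobiSym (p : ℤ) e = jacobiSym (-1 * 3) e := by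
      apply jacobiSym.mod_left'
      rw [hpez, show (2 * e * N - 3 : ℤ) = -1 * 3 + e * (2 * N) by ring, Int.add_mul_emod_self_left]
    rw [this, jacobiSym.mul_left, (sym_three e he12).1, (sym_three e he12).2]; rfl)
  refine ternary_red N (by omega) _ A p N 0 1 f hA (by rw [hAf]; omega) ?_ le_rfl ⟨0, 0, 1, by ring⟩
  linear_combination (N : ℤ) * hAf - hpez

theorem tern_case2 (M : ℕ) (h8 : M % 8 = 7) (h3 : M % 3 = 1) :
    ∃ X Y Z : ℤ, X ^ 2 + Y ^ 2 + 3 * Z ^ 2 = 3 * M := by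
  obtain ⟨q, hq⟩ : ∃ q, 3 * q + 1 = 10 * M := ⟨(10 * M - 1) / 3, by omega⟩
  have hcop : q.Coprime (8 * M) := by
    apply Nat.Coprime.mul_right
    · have h2 : q.Coprime 2 := by
        rw [Nat.coprime_comm, Nat.Prime.coprime_iff_not_dvd Nat.prime_two]; omega
      exact Nat.Coprime.pow_right 3 h2
    · have : Nat.gcd q M ∣ 1 := by
        have h1 := (Nat.gcd_dvd_left q M).mul_left 3
        have h2 := (Nat.gcd_dvd_right q M).mul_left 10
        have := Nat.dvd_sub h2 h1
        rwa [show 10 * M - 3 * q = 1 by omega] at this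
      exact Nat.dvd_one.mp this
  obtain ⟨p, hgt, hp, hmod⟩ := Nat.forall_exists_prime_gt_and_modEq q (by omega) hcop
  obtain ⟨k, hk⟩ := (Nat.modEq_iff_dvd' (by omega)).mp hmod.symm
  have : Fact p.Prime := ⟨hp⟩
  obtain ⟨e, he⟩ : ∃ e, e = 12 * k + 5 := ⟨_, rfl⟩
  have hpe : 3 * p + 1 = 2 * e * M := by
    have : p = 8 * M * k + q := by omega
    have h3 : 3 * p + 1 = 3 * (8 * M * k) + 10 * M := by omega
    rw [h3, he]; ring
  have hpez : 3 * (p : ℤ) = 2 * e * M - 1 := by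
    have : ((3 * p + 1 : ℕ) : ℤ) = ((2 * e * M : ℕ) : ℤ) := by rw [hpe]
    push_cast at this; linarith
  have hp8 : p % 8 = 7 := by
    have h1 : (e * M) % 4 = 3 := by rw [Nat.mul_mod, show e % 4 = 1 by omega, show M % 4 = 3 by omega]
    rw [mul_assoc] at hpe
    omega
  have he12 : e % 12 = 5 := by omega
  obtain ⟨A, f, hA, hAf⟩ := sym_aux e p he12 hp8 (by
    have : jacobiSym (3 * (p : ℤ)) e = jacobiSym (-1) e := by
      apply jacobiSym.mod_left'
      rw [hpez, show (2 * e * M - 1 : ℤ) = -1 + e * (2 * M) by ring, Int.add_mul_emod_self_left]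
    rw [jacobiSym.mul_left, (sym_three e he12).1, (sym_three e he12).2] at this
    linarith)
  refine ternary_red (3 * M) (by omega) _ A p (3 * M) 0 3 f hA (by rw [hAf]; omega) ?_ le_rfl ⟨0, 0, 1, by ring⟩
  linear_combination (3 * M : ℤ) * hAf - 3 * hpez

theorem large (n : ℕ) (hn : 42000 ≤ n) :
    ∃ x₁ x₂ x₃ x₄ : ℕ, n = pent x₁ + pent x₂ + pent x₃ + 3 * pent x₄ := by
  have hr : ∃ r < 18, (r + n) % 2 = 1 ∧ (2 * r + 1 + 2 * n) % 3 = 0 ∧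
      (n % 3 = 0 → (4 * n + 1) % 9 = (4 * r ^ 2 + 3) % 9) := by
    have h : ∀ t < 18, ∃ r < 18, (r + t) % 2 = 1 ∧ (2 * r + 1 + 2 * t) % 3 = 0 ∧
      (t % 3 = 0 → (4 * t + 1) % 9 = (4 * r ^ 2 + 3) % 9) := by decide
    obtain ⟨r, h0, h1, h2, h3⟩ := h (n % 18) (Nat.mod_lt _ (by norm_num))
    exact ⟨r, h0, by omega, by omega, fun h => by have := h3 (by omega); omega⟩
  obtain ⟨r, hr, hr2, hr3, hr9⟩ := hr
  obtain ⟨m, hmr, hle, hlt⟩ := choose_m n r hn hr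
  have sq2 : m ^ 2 % 2 = m % 2 := by
    rcases Nat.mod_two_eq_zero_or_one m with h | h <;> simp [Nat.pow_mod, h]
  have sq3 : (m % 3 = 0 ∧ m ^ 2 % 3 = 0) ∨ (m % 3 ≠ 0 ∧ m ^ 2 % 3 = 1) := by
    have : m % 3 = 0 ∨ m % 3 = 1 ∨ m % 3 = 2 := by omega
    rcases this with h | h | h <;> simp [Nat.pow_mod, h]
  have sq9 : m ^ 2 % 9 = r ^ 2 % 9 := by
    rw [Nat.pow_mod, Nat.pow_mod r, show m % 9 = r % 9 by omega]
  obtain ⟨N, hN⟩ : ∃ N, N = 4 * (n - m ^ 2) + 1 := ⟨_, rfl⟩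
  have hex : ∃ X Y Z : ℤ, X ^ 2 + Y ^ 2 + 3 * Z ^ 2 = N := by
    by_cases h3 : n % 3 = 0
    · have h9 := hr9 h3
      obtain ⟨M, hM⟩ : ∃ M, N = 3 * M := ⟨N / 3, by omega⟩
      rw [hM]; push_cast
      exact tern_case2 M (by omega) (by omega)
    · have hm3 : (2 * m + 1 + 2 * n) % 3 = 0 := by omega
      clear hr9 sq9 hlt hr3
      have hN3 : N % 3 = 2 := by
        clear sq2
        have h12 : n % 3 = 1 ∨ n % 3 = 2 := by omega
        rcases h12 with h12 | h12
        · have : m % 3 = 0 := by omega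
          have : m ^ 2 % 3 = 0 := by omega
          omega
        · have : m % 3 = 2 := by omega
          have : m ^ 2 % 3 = 1 := by omega
          omega
      have hN8 : N % 8 = 5 := by omega
      exact tern_case1 N hN8 hN3
  obtain ⟨X, Y, Z, h⟩ := hex
  refine finish n m X Y Z (by omega) (by exact_mod_cast hlt) (by omega) ?_
  rw [h, hN]; push_cast [Nat.cast_sub hle]; ring

theorem sum_pentagonal_1113_range :
    {n : ℕ | ∃ x₁ x₂ x₃ x₄ : ℕ,
        n = x₁ * (3 * x₁ - 1) / 2 + x₂ * (3 * x₂ - 1) / 2 + x₃ * (3 * x₃ - 1) / 2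
            + 3 * (x₄ * (3 * x₄ - 1) / 2)}
      = {n : ℕ | n ≠ 19} := by
  ext n
  constructor
  · rintro ⟨a, b, c, d, h⟩ rfl
    exact no19 a b c d h
  · intro h
    rcases lt_or_ge n 42000 with hn | hn
    · exact small n hn h
    · exact large n hn
end

section
/- The set of all sums p₆(x₁) + p₆(x₂) + p₆(x₃) + 3·p₆(x₄) with x₁, x₂, x₃, x₄ nonnegative integers equals the set of all nonnegative integers except 14, 23, 41, 42, 83. -/
/-- The hexagonal number. -/
def hexP (x : ℕ) : ℕ := x * (2 * x - 1)

/-- Bit mask of hexagonal numbers. -/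
def hexM1 : ℕ := (List.range 38).foldl (fun s i => s ||| (1 <<< hexP i)) 0

/-- Bit mask of sums of two hexagonal numbers. -/
def hexM2 : ℕ := (List.range 38).foldl (fun s i => s ||| (hexM1 <<< hexP i)) 0

theorem hexM1_spec : ∀ i < 55, ∀ j < 50, hexM1.testBit (50 * i + j) = true →
    ∃ c < 38, 50 * i + j = hexP c := by
  decide +kernel

theorem hexM2_spec : ∀ i < 55, ∀ j < 50, hexM2.testBit (50 * i + j) = true →
    ∃ c < 38, hexP c ≤ 50 * i + j ∧ hexM1.testBit (50 * i + j - hexP c) = true := by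
  decide +kernel

theorem hex_small_aux : ∀ i < 55, ∀ j < 50, (50 * i + j) ∈ [14, 23, 41, 42, 83] ∨
    ∃ d < 38, 3 * hexP d ≤ 50 * i + j ∧ ∃ a < 38, 3 * hexP d + hexP a ≤ 50 * i + j ∧
      hexM2.testBit (50 * i + j - (3 * hexP d + hexP a)) = true := by
  decide +kernel

theorem hex_small (n : ℕ) (hn : n < 2750) (hne : n ∉ [14, 23, 41, 42, 83]) :
    ∃ a b c d : ℕ, n = hexP a + hexP b + hexP c + 3 * hexP d := by
  have key : ∀ r : ℕ, 50 * (r / 50) + r % 50 = r := fun r => Nat.div_add_mod r 50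
  have h0 := hex_small_aux (n / 50) (by omega) (n % 50) (by omega)
  rw [key] at h0
  obtain ⟨d, -, h1, a, -, h2, h3⟩ := h0.resolve_left hne
  obtain ⟨r, hr⟩ : ∃ r, r = n - (3 * hexP d + hexP a) := ⟨_, rfl⟩
  rw [← hr] at h3
  have h4 := hexM2_spec (r / 50) (by omega) (r % 50) (by omega)
  rw [key] at h4
  obtain ⟨b, -, h5, h6⟩ := h4 h3
  obtain ⟨u, hu⟩ : ∃ u, u = r - hexP b := ⟨_, rfl⟩
  rw [← hu] at h6
  have h7 := hexM1_spec (u / 50) (by omega) (u % 50) (by omega)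
  rw [key] at h7
  obtain ⟨c, -, h8⟩ := h7 h6
  exact ⟨a, b, c, d, by omega⟩

set_option synthInstance.maxHeartbeats 400000 in
set_option synthInstance.maxSize 2000 in
theorem hex_exc : ∀ a < 8, ∀ b < 8, ∀ c < 8, ∀ d < 8,
    (hexP a + hexP b + hexP c + 3 * hexP d) ∉ [14, 23, 41, 42, 83] := by
  decide +kernel

theorem hexP_lt {x : ℕ} (h : hexP x ≤ 83) : x < 8 := by
  by_contra hx
  push Not at hx
  unfold hexP at h
  have : 8 * 15 ≤ x * (2 * x - 1) := Nat.mul_le_mul hx (by omega)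
  omega

open scoped NumberTheorySymbols

/-- Dirichlet's theorem and quadratic reciprocity supply a prime `q` for the ternary form. -/
theorem exists_prime_disc (m : ℕ) (hm : 0 < m) (h3 : ¬ 3 ∣ m) :
    ∃ (q k : ℕ) (t a : ℤ), 0 < q ∧ q + 3 = m * (4 + 48 * k) ∧
      a * q = t ^ 2 + (4 + 48 * k) := by
  have hcop : Nat.Coprime (4 * m - 3) (48 * m) := by
    by_contra hc
    obtain ⟨p, hp, hp1, hp2⟩ := Nat.Prime.not_coprime_iff_dvd.mp hc
    have h5 : p ∣ m → False := by
      intro hpm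
      have h6 : p ∣ 3 := by
        have := Nat.dvd_sub (Dvd.dvd.mul_left hpm 4) hp1
        rwa [show 4 * m - (4 * m - 3) = 3 by omega] at this
      rw [(Nat.prime_dvd_prime_iff_eq hp Nat.prime_three).mp h6] at hpm
      exact h3 hpm
    rcases (Nat.Prime.dvd_mul hp).mp hp2 with h4 | h4
    · rw [show 48 = 2 ^ 4 * 3 by norm_num] at h4
      rcases (Nat.Prime.dvd_mul hp).mp h4 with h4 | h4
      · have := (Nat.prime_dvd_prime_iff_eq hp Nat.prime_two).mp (hp.dvd_of_dvd_pow h4)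
        subst this
        omega
      · have := (Nat.prime_dvd_prime_iff_eq hp Nat.prime_three).mp h4
        subst this
        omega
    · exact h5 h4
  obtain ⟨q, hgt, hp, hmod⟩ :=
    Nat.forall_exists_prime_gt_and_modEq (4 * m) (q := 48 * m) (by omega) hcop
  obtain ⟨k, hk⟩ : ∃ k, q = 4 * m - 3 + 48 * m * k := by
    have := (Nat.modEq_iff_dvd' (by omega : 4 * m - 3 ≤ q)).mp hmod.symm
    obtain ⟨k, hk⟩ := this
    exact ⟨k, by omega⟩
  have hq3 : q + 3 = m * (4 + 48 * k) := by
    have : 48 * m * k = m * (48 * k) := by ring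
    rw [mul_add]; omega
  have hq4 : q % 4 = 1 := by
    have : q + 3 = 4 * (m * (1 + 12 * k)) := by rw [hq3]; ring
    omega
  have : Fact q.Prime := ⟨hp⟩
  have hqodd : Odd q := Nat.odd_iff.mpr (by omega)
  have hdodd : Odd (1 + 12 * k) := Nat.odd_iff.mpr (by omega)
  have j1 : J(-1 | q) = 1 := by
    rw [jacobiSym.at_neg_one hqodd, ZMod.χ₄_nat_one_mod_four hq4]
  have j2 : J(((1 + 12 * k : ℕ) : ℤ) | q) = 1 := by
    rw [jacobiSym.quadratic_reciprocity_one_mod_four (by omega) hqodd]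
    have e1 : J((q : ℤ) | 1 + 12 * k) = J(-3 | 1 + 12 * k) := by
      apply jacobiSym.mod_left'
      apply Int.ModEq.symm
      rw [Int.modEq_iff_dvd]
      refine ⟨4 * m, ?_⟩
      have : (q : ℤ) + 3 = m * (4 + 48 * k) := by exact_mod_cast hq3
      push_cast
      linarith
    rw [e1, jacobiSym.neg _ hdodd, ZMod.χ₄_nat_one_mod_four (by omega), one_mul]
    have e2 := jacobiSym.quadratic_reciprocity_one_mod_four (a := 1 + 12 * k) (b := 3)
      (by omega) (by decide)
    have e3 : J(((1 + 12 * k : ℕ) : ℤ) | 3) = J(1 | 3) := by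
      apply jacobiSym.mod_left'
      push_cast
      omega
    rw [e3, jacobiSym.one_left] at e2
    exact_mod_cast e2.symm
  have j3 : J(-(4 * ((1 + 12 * k : ℕ) : ℤ)) | q) = 1 := by
    rw [neg_eq_neg_one_mul, jacobiSym.mul_left, jacobiSym.mul_left, j1, j2,
      jacobiSym.at_four hqodd]
    norm_num
  have hsq := ZMod.isSquare_of_jacobiSym_eq_one j3
  obtain ⟨y, hy⟩ := hsq
  obtain ⟨t, rfl⟩ := ZMod.intCast_surjective y
  have hz : ((t ^ 2 + (4 + 48 * k) : ℤ) : ZMod q) = 0 := by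
    push_cast at hy ⊢
    linear_combination -hy
  rw [ZMod.intCast_zmod_eq_zero_iff_dvd] at hz
  obtain ⟨a, ha⟩ := hz
  exact ⟨q, k, t, a, hp.pos, hq3, by rw [ha]; ring⟩

/-- Positive ternary forms of determinant `3` with two orthogonal vectors of norms `m`, `q`. -/
def TForm (m q a b c r s t : ℤ) : Prop :=
  0 < a ∧ 0 < a * b - t ^ 2 ∧
  a * b * c + 2 * r * s * t - a * r ^ 2 - b * s ^ 2 - c * t ^ 2 = 3 ∧
  ∃ x y z u v w : ℤ,
    a * x ^ 2 + b * y ^ 2 + c * z ^ 2 + 2 * r * y * z + 2 * s * x * z + 2 * t * x * y = m ∧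
    a * u ^ 2 + b * v ^ 2 + c * w ^ 2 + 2 * r * v * w + 2 * s * u * w + 2 * t * u * v = q ∧
    a * x * u + b * y * v + c * z * w + r * (y * w + z * v) + s * (x * w + z * u)
      + t * (x * v + y * u) = 0

theorem TForm.swap12 {m q a b c r s t : ℤ} (h : TForm m q a b c r s t) :
    TForm m q b a c s r t := by
  obtain ⟨h1, h2, h3, x, y, z, u, v, w, h4, h5, h6⟩ := h
  refine ⟨?_, by linarith, by linarith, y, x, z, v, u, w, by linarith, by linarith, by linarith⟩
  have : 0 < a * b := by nlinarith [sq_nonneg t]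
  exact (pos_iff_pos_of_mul_pos this).mp h1

theorem TForm.swap23 {m q a b c r s t : ℤ} (h : TForm m q a b c r s t) :
    TForm m q a c b r t s := by
  obtain ⟨h1, h2, h3, x, y, z, u, v, w, h4, h5, h6⟩ := h
  refine ⟨h1, ?_, by linarith, x, z, y, u, w, v, by linarith, by linarith, by linarith⟩
  have : 0 < (a * b - t ^ 2) * (a * c - s ^ 2) := by
    have e : (a * b - t ^ 2) * (a * c - s ^ 2) = (a * r - s * t) ^ 2 + a * 3 := by
      rw [← h3]; ring
    rw [e]; positivity
  exact (pos_iff_pos_of_mul_pos this).mp h2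

theorem TForm.shift12 {m q a b c r s t : ℤ} (h : TForm m q a b c r s t) (k : ℤ) :
    TForm m q a (b + 2 * k * t + k ^ 2 * a) c (r + k * s) s (t + k * a) := by
  obtain ⟨h1, h2, h3, x, y, z, u, v, w, h4, h5, h6⟩ := h
  refine ⟨h1, by linarith, by rw [← h3]; ring, x - k * y, y, z, u - k * v, v, w, ?_, ?_, ?_⟩
  · rw [← h4]; ring
  · rw [← h5]; ring
  · rw [← h6]; ring

theorem TForm.shift23 {m q a b c r s t : ℤ} (h : TForm m q a b c r s t) (k : ℤ) :
    TForm m q a b (c + 2 * k * r + k ^ 2 * b) (r + k * b) (s + k * t) t := by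
  obtain ⟨h1, h2, h3, x, y, z, u, v, w, h4, h5, h6⟩ := h
  refine ⟨h1, h2, by rw [← h3]; ring, x, y - k * z, z, u, v - k * w, w, ?_, ?_, ?_⟩
  · rw [← h4]; ring
  · rw [← h5]; ring
  · rw [← h6]; ring

theorem exists_round (p a : ℤ) (ha : 0 < a) : ∃ k : ℤ, |2 * (p + k * a)| ≤ a := by
  refine ⟨-((2 * p + a) / (2 * a)), ?_⟩
  have h1 := Int.emod_add_mul_ediv (2 * p + a) (2 * a)
  have h2 := Int.emod_nonneg (2 * p + a) (by omega : 2 * a ≠ 0)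
  have h3 := Int.emod_lt_of_pos (2 * p + a) (by omega : 0 < 2 * a)
  rw [abs_le]
  constructor <;> nlinarith

/-- Reduction of ternary forms. -/
theorem TForm.reduce {m q a b c r s t : ℤ} (h : TForm m q a b c r s t) :
    ∃ a b c r s t : ℤ, TForm m q a b c r s t ∧ |2 * t| ≤ a ∧ a ≤ b ∧
      |2 * (a * r - s * t)| ≤ a * b - t ^ 2 ∧ a * b - t ^ 2 ≤ a * c - s ^ 2 := by
  classical
  have hex : ∃ n : ℕ, ∃ b c r s t, TForm m q (n : ℤ) b c r s t :=
    ⟨a.toNat, b, c, r, s, t, by rw [Int.toNat_of_nonneg h.1.le]; exact h⟩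
  have hmin := fun n hn => Nat.find_min' (m := n) hex hn
  obtain ⟨b, c, r, s, t, h⟩ := Nat.find_spec hex
  obtain ⟨A, hA⟩ : ∃ A, A = Nat.find hex := ⟨_, rfl⟩
  rw [← hA] at hmin h
  have hex2 : ∃ n : ℕ, ∃ b c r s t, TForm m q (A : ℤ) b c r s t ∧ (n : ℤ) = A * b - t ^ 2 :=
    ⟨(A * b - t ^ 2).toNat, b, c, r, s, t, h, by rw [Int.toNat_of_nonneg h.2.1.le]⟩
  have hmin2 := fun n hn => Nat.find_min' (m := n) hex2 hn
  obtain ⟨b, c, r, s, t, h, hB⟩ := Nat.find_spec hex2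
  obtain ⟨B, hB2⟩ : ∃ B, B = Nat.find hex2 := ⟨_, rfl⟩
  rw [← hB2] at hmin2 hB
  obtain ⟨k, hk⟩ := exists_round t A h.1
  have g := h.shift12 k
  have gB : (B : ℤ) = A * (b + 2 * k * t + k ^ 2 * A) - (t + k * A) ^ 2 := by rw [hB]; ring
  generalize b + 2 * k * t + k ^ 2 * A = b' at g gB
  generalize t + k * A = t' at g gB hk
  generalize r + k * s = r' at g
  obtain ⟨l, hl⟩ := exists_round (A * r' - s * t') B (by rw [gB]; exact g.2.1)
  have f := g.shift23 l
  refine ⟨A, _, _, _, _, _, f, hk, ?_, ?_, ?_⟩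
  · have f' := f.swap12
    have := hmin b'.toNat ⟨_, _, _, _, _, by rw [Int.toNat_of_nonneg f'.1.le]; exact f'⟩
    have := f'.1
    omega
  · rw [← gB]
    convert hl using 3
    rw [gB]; ring
  · have f' := f.swap23
    have h2 := f'.2.1
    rw [← gB]
    have := hmin2 (Int.toNat _) ⟨_, _, _, _, _, f', Int.toNat_of_nonneg h2.le⟩
    omega

set_option maxHeartbeats 2000000 in
theorem ternary_rep (m : ℕ) (hm : 0 < m) (h3 : ¬ 3 ∣ m) :
    ∃ x y z : ℤ, x ^ 2 + y ^ 2 + 3 * z ^ 2 = m := by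
  obtain ⟨q, k, t, a, hq, hqm, ha⟩ := exists_prime_disc m hm h3
  have hqm' : (q : ℤ) + 3 = m * (4 + 48 * k) := by exact_mod_cast hqm
  have hq' : (0 : ℤ) < q := by exact_mod_cast hq
  have hT : TForm m q a q m 0 1 t := by
    refine ⟨?_, ?_, ?_, 0, 0, 1, 0, 1, 0, by ring, by ring, by ring⟩
    · have : 0 < a * q := by rw [ha]; positivity
      exact (pos_iff_pos_of_mul_pos this).mpr hq'
    · rw [ha]; ring_nf; positivity
    · linear_combination (m : ℤ) * ha - hqm'
  have hmq : (m * q : ℤ) % 3 = 1 := by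
    have e : (m * q : ℤ) = m ^ 2 + 3 * (m ^ 2 * (1 + 16 * k) - m) := by
      linear_combination (m : ℤ) * hqm'
    have e2 : (m : ℤ) % 3 = 1 ∨ (m : ℤ) % 3 = 2 := by omega
    rw [e, Int.add_mul_emod_self_left]
    rcases e2 with e2 | e2 <;> simp [pow_two, Int.mul_emod, e2]
  obtain ⟨a, b, c, r, s, t, h, i1, i2, i3, i4⟩ := hT.reduce
  obtain ⟨h1, h2, h3, x, y, z, u, v, w, h4, h5, h6⟩ := h
  obtain ⟨β, hβ⟩ : ∃ β, β = a * b - t ^ 2 := ⟨_, rfl⟩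
  obtain ⟨γ, hγ⟩ : ∃ γ, γ = a * c - s ^ 2 := ⟨_, rfl⟩
  obtain ⟨ρ, hρ⟩ : ∃ ρ, ρ = a * r - s * t := ⟨_, rfl⟩
  rw [← hβ] at h2 i3 i4
  rw [← hγ] at i4
  rw [← hρ] at i3
  have e1 : β * γ - ρ ^ 2 = 3 * a := by rw [hβ, hγ, hρ, ← h3]; ring
  have e2 : (2 * ρ) ^ 2 ≤ β ^ 2 := sq_le_sq' (by linarith [(abs_le.mp i3).1]) (abs_le.mp i3).2
  have e3 : (2 * t) ^ 2 ≤ a ^ 2 := sq_le_sq' (by linarith [(abs_le.mp i1).1]) (abs_le.mp i1).2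
  have e4 : β ^ 2 ≤ 4 * a := by nlinarith
  have e5 : 3 * a ^ 2 ≤ 4 * β := by nlinarith
  have ha1 : a = 1 := by
    have e6 : (3 * a ^ 2) ^ 2 ≤ (4 * β) ^ 2 := by gcongr
    have e7 : 9 * a ^ 3 ≤ 64 := by
      have e8 : a * (9 * a ^ 3) ≤ a * 64 := by linarith
      exact le_of_mul_le_mul_left e8 h1
    by_contra hc
    have : 2 ≤ a := by omega
    have : 2 ^ 3 ≤ a ^ 3 := by gcongr
    omega
  subst ha1
  have ht : t = 0 := by
    rw [abs_le] at i1; omega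
  subst ht
  have hb : b = β := by rw [hβ]; ring
  have hr : ρ = r := by rw [hρ]; ring
  subst hr
  subst hb
  have hb2 : b ≤ 2 := by
    clear h4 h5 h6 hmq hqm hqm' ha e1 e2 e3 e5 h3
    nlinarith
  rw [abs_le] at i3
  obtain rfl | rfl : b = 1 ∨ b = 2 := by omega
  · obtain rfl : ρ = 0 := by omega
    have hc : c = 3 + s ^ 2 := by linarith
    refine ⟨x + s * z, y, z, ?_⟩
    rw [← h4, hc]; ring
  · exfalso
    have hρ2 : ρ = 1 ∨ ρ = -1 := by
      have : ρ = 1 ∨ ρ = -1 ∨ ρ = 0 := by omega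
      rcases this with h | h | h
      · exact Or.inl h
      · exact Or.inr h
      · subst h; omega
    have hρ1 : ρ ^ 2 = 1 := by rcases hρ2 with h | h <;> rw [h] <;> norm_num
    have hc : c = 2 + s ^ 2 := by linarith
    subst hc
    have key : ∃ N : ℤ, (m * q : ℤ) = 2 * ((x + s * z) * (v - ρ * w) - (u + s * w) * (y - ρ * z)) ^ 2
        + 3 * N := by
      obtain ⟨M0, hM0⟩ : ∃ M0, M0 = (x + s * z) ^ 2 + 2 * (y - ρ * z) ^ 2 := ⟨_, rfl⟩
      obtain ⟨Q0, hQ0⟩ : ∃ Q0, Q0 = (u + s * w) ^ 2 + 2 * (v - ρ * w) ^ 2 := ⟨_, rfl⟩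
      have k1 : (m : ℤ) = M0 + 6 * (ρ * y * z) := by
        rw [hM0]; linear_combination -h4 - 2 * z ^ 2 * hρ1
      have k2 : (q : ℤ) = Q0 + 6 * (ρ * v * w) := by
        rw [hQ0]; linear_combination -h5 - 2 * w ^ 2 * hρ1
      have k3 : (x + s * z) * (u + s * w) + 2 * (y - ρ * z) * (v - ρ * w)
          = -3 * ρ * (y * w + z * v) := by
        linear_combination h6 + 2 * z * w * hρ1
      have k4 : M0 * Q0 = 2 * ((x + s * z) * (v - ρ * w) - (u + s * w) * (y - ρ * z)) ^ 2
          + (-3 * ρ * (y * w + z * v)) ^ 2 := by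
        rw [hM0, hQ0, ← k3]; ring
      refine ⟨2 * (ρ * y * z) * Q0 + 2 * (ρ * v * w) * M0 + 12 * (ρ * y * z) * (ρ * v * w)
        + 3 * (ρ * (y * w + z * v)) ^ 2, ?_⟩
      rw [k1, k2]
      linear_combination k4
    obtain ⟨N, hN⟩ := key
    rw [hN, Int.add_mul_emod_self_left] at hmq
    generalize (x + s * z) * (v - ρ * w) - (u + s * w) * (y - ρ * z) = D at hmq
    have : D % 3 = 0 ∨ D % 3 = 1 ∨ D % 3 = 2 := by omega
    rcases this with h | h | h <;> simp [pow_two, Int.mul_emod, h] at hmq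

theorem parity_rep (m : ℕ) (hm : m % 4 = 0 ∨ m % 4 = 1) (hm3 : m % 3 = 2) :
    ∃ x y z : ℤ, x ^ 2 + y ^ 2 + 3 * z ^ 2 = m ∧ (y - z) % 2 = 0 := by
  obtain ⟨x, y, z, h⟩ := ternary_rep m (by omega) (by omega)
  by_cases hyz : (y - z) % 2 = 0
  · exact ⟨x, y, z, h, hyz⟩
  by_cases hxz : (x - z) % 2 = 0
  · exact ⟨y, x, z, by linarith, hxz⟩
  exfalso
  have sq : ∀ k : ℤ, (k % 2 = 0 ∧ k ^ 2 % 4 = 0) ∨ (k % 2 = 1 ∧ k ^ 2 % 4 = 1) := by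
    intro k
    rcases Int.emod_two_eq_zero_or_one k with h | h
    · left
      obtain ⟨j, rfl⟩ : ∃ j, k = 2 * j := ⟨k / 2, by omega⟩
      refine ⟨h, ?_⟩
      rw [show (2 * j) ^ 2 = 4 * j ^ 2 by ring]; omega
    · right
      obtain ⟨j, rfl⟩ : ∃ j, k = 2 * j + 1 := ⟨k / 2, by omega⟩
      refine ⟨h, ?_⟩
      rw [show (2 * j + 1) ^ 2 = 4 * (j ^ 2 + j) + 1 by ring]; omega
  have h1 := sq x
  have h2 := sq y
  have h3 := sq z
  generalize x ^ 2 = X at *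
  generalize y ^ 2 = Y at *
  generalize z ^ 2 = Z at *
  omega

theorem sq_mod_three (k : ℤ) : (k % 3 = 0 ∧ k ^ 2 % 3 = 0) ∨ (k % 3 ≠ 0 ∧ k ^ 2 % 3 = 1) := by
  have : k % 3 = 0 ∨ k % 3 = 1 ∨ k % 3 = 2 := by omega
  rcases this with h | h | h <;> simp [pow_two, Int.mul_emod, h]

theorem sign_fix (k b : ℤ) (hk : k % 3 ≠ 0) (hb : b % 3 ≠ 0) :
    ∃ k' : ℤ, k' ^ 2 = k ^ 2 ∧ (k' - b) % 3 = 0 ∧ (k' - k) % 2 = 0 := by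
  by_cases h : (k - b) % 3 = 0
  · exact ⟨k, rfl, h, by omega⟩
  · refine ⟨-k, by ring, ?_, by omega⟩
    have h1 : k % 3 = 1 ∨ k % 3 = 2 := by omega
    have h2 : b % 3 = 1 ∨ b % 3 = 2 := by omega
    rcases h1 with h1 | h1 <;> rcases h2 with h2 | h2 <;> omega

/-- Analogue of Cauchy's lemma. -/
theorem cauchy_like (a b : ℤ) (hpar : (a - b) % 2 = 0) (h3 : b % 3 ≠ 0) (hpos : b ^ 2 < 6 * a) :
    ∃ x y z w : ℤ, x ^ 2 + y ^ 2 + z ^ 2 + 3 * w ^ 2 = a ∧ x + y + z + 3 * w = b := by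
  obtain ⟨m, hm⟩ : ∃ m : ℕ, (m : ℤ) = 6 * a - b ^ 2 :=
    ⟨(6 * a - b ^ 2).toNat, Int.toNat_of_nonneg (by linarith)⟩
  have hb3 := sq_mod_three b
  have hb4 : (b % 2 = 0 ∧ b ^ 2 % 4 = 0) ∨ (b % 2 = 1 ∧ b ^ 2 % 4 = 1) := by
    rcases Int.emod_two_eq_zero_or_one b with h | h
    · left
      obtain ⟨j, rfl⟩ : ∃ j, b = 2 * j := ⟨b / 2, by omega⟩
      refine ⟨h, ?_⟩
      rw [show (2 * j) ^ 2 = 4 * j ^ 2 by ring]; omega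
    · right
      obtain ⟨j, rfl⟩ : ∃ j, b = 2 * j + 1 := ⟨b / 2, by omega⟩
      refine ⟨h, ?_⟩
      rw [show (2 * j + 1) ^ 2 = 4 * (j ^ 2 + j) + 1 by ring]; omega
  obtain ⟨x, y, z, hxyz, hyz⟩ := parity_rep m (by omega) (by omega)
  have hx3 := sq_mod_three x
  have hy3 := sq_mod_three y
  obtain ⟨σ, hσ, hσ3, hσ2⟩ := sign_fix x b (by omega) h3
  obtain ⟨Y, hY, hY3, hY2⟩ := sign_fix y (-b) (by omega) (by omega)
  have hsum : σ ^ 2 + Y ^ 2 + 3 * z ^ 2 = 6 * a - b ^ 2 := by rw [hσ, hY, hxyz, hm]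
  obtain ⟨p, hp⟩ : ∃ p, Y = 2 * p + z := ⟨(Y - z) / 2, by omega⟩
  subst hp
  have hσb : (σ - b) % 2 = 0 := by
    have e : (σ - b) * (σ + b) = 2 * (3 * a - b ^ 2 - 2 * p ^ 2 - 2 * p * z - 2 * z ^ 2) := by
      linear_combination hsum
    have h2 : (2 : ℤ) ∣ (σ - b) * (σ + b) := ⟨_, e⟩
    rcases Int.prime_two.dvd_mul.mp h2 with h | h <;> omega
  obtain ⟨w, hw⟩ : ∃ w, b = σ + 6 * w := ⟨(b - σ) / 6, by omega⟩
  obtain ⟨u, hu⟩ : ∃ u, σ = 3 * u + 2 * z + p := ⟨(σ - 2 * z - p) / 3, by omega⟩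
  refine ⟨u + z + p + w, u + z + w, u + w, w, ?_, by linarith⟩
  subst hu
  subst hw
  have : 6 * ((u + z + p + w) ^ 2 + (u + z + w) ^ 2 + (u + w) ^ 2 + 3 * w ^ 2) = 6 * a := by
    linear_combination hsum
  linarith

theorem cauchy_nonneg (a b : ℤ) (hpar : (a - b) % 2 = 0) (h3 : b % 3 ≠ 0) (hpos : b ^ 2 < 6 * a)
    (hb : 0 ≤ b) (h5 : 5 * (a - 1) < (b + 1) ^ 2) :
    ∃ x y z w : ℤ, 0 ≤ x ∧ 0 ≤ y ∧ 0 ≤ z ∧ 0 ≤ w ∧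
      x ^ 2 + y ^ 2 + z ^ 2 + 3 * w ^ 2 = a ∧ x + y + z + 3 * w = b := by
  obtain ⟨x, y, z, w, h1, h2⟩ := cauchy_like a b hpar h3 hpos
  have key : ∀ x y z : ℤ, x ^ 2 + y ^ 2 + z ^ 2 + 3 * w ^ 2 = a → x + y + z + 3 * w = b →
      0 ≤ x := by
    intro x y z h1 h2
    by_contra hx
    push Not at hx
    have e1 : 1 ≤ x ^ 2 := by nlinarith
    have e2 : (y + z + 3 * w) ^ 2 ≤ 5 * (y ^ 2 + z ^ 2 + 3 * w ^ 2) := by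
      nlinarith [sq_nonneg (y - z), sq_nonneg (y - w), sq_nonneg (z - w)]
    have e3 : (b + 1) ^ 2 ≤ (y + z + 3 * w) ^ 2 := by
      apply pow_le_pow_left₀ <;> linarith
    linarith
  refine ⟨x, y, z, w, key x y z h1 h2, key y x z (by linarith) (by linarith),
    key z x y (by linarith) (by linarith), ?_, h1, h2⟩
  by_contra hw
  push Not at hw
  have e1 : 1 ≤ w ^ 2 := by nlinarith
  have e2 : (x + y + z) ^ 2 ≤ 3 * (x ^ 2 + y ^ 2 + z ^ 2) := by
    nlinarith [sq_nonneg (y - z), sq_nonneg (y - x), sq_nonneg (z - x)]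
  have e3 : (b + 1) ^ 2 ≤ (x + y + z) ^ 2 := by
    apply pow_le_pow_left₀ <;> linarith
  nlinarith [sq_nonneg x, sq_nonneg y, sq_nonneg z]

theorem hexP_toNat (x : ℤ) (hx : 0 ≤ x) : (hexP x.toNat : ℤ) = 2 * x ^ 2 - x := by
  obtain ⟨n, rfl⟩ := Int.eq_ofNat_of_zero_le hx
  unfold hexP
  rcases n with _ | n
  · simp
  · rw [Int.toNat_natCast, show 2 * (n + 1) - 1 = 2 * n + 1 by omega]
    push_cast
    ring

theorem hex_large (n : ℕ) (hn : 2750 ≤ n) :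
    ∃ a b c d : ℕ, n = hexP a + hexP b + hexP c + 3 * hexP d := by
  obtain ⟨S, hS⟩ : ∃ S, S = Nat.sqrt (5 * n / 2) := ⟨_, rfl⟩
  have hS1 : S * S ≤ 5 * n / 2 := by rw [hS]; exact Nat.sqrt_le _
  have hS2 : 5 * n / 2 < (S + 1) * (S + 1) := by rw [hS]; exact Nat.lt_succ_sqrt _
  have i1 : 2 * ((S : ℤ) * S) ≤ 5 * n := by
    have : 2 * (S * S) ≤ 5 * n := by omega
    exact_mod_cast this
  have i2 : 5 * (n : ℤ) < 2 * ((S + 1) * (S + 1)) := by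
    have : 5 * n < 2 * ((S + 1) * (S + 1)) := by omega
    exact_mod_cast this
  have hn' : (2750 : ℤ) ≤ n := by exact_mod_cast hn
  have i3 : 30 * (S : ℤ) + 108 < n := by
    by_contra hc
    push Not at hc
    nlinarith
  obtain ⟨b, hb1, hb2, hb4, hb3⟩ : ∃ b : ℤ, S + 2 ≤ b ∧ b ≤ S + 9 ∧ (n - b) % 4 = 0 ∧
      b % 3 ≠ 0 := by
    obtain ⟨b, hb⟩ : ∃ b : ℤ, b = S + 2 + (n - (S + 2)) % 4 := ⟨_, rfl⟩
    by_cases h : b % 3 = 0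
    · exact ⟨b + 4, by omega, by omega, by omega, by omega⟩
    · exact ⟨b, by omega, by omega, by omega, h⟩
  obtain ⟨a, ha⟩ : ∃ a : ℤ, n + b = 2 * a := ⟨(n + b) / 2, by omega⟩
  have hS0 : (0 : ℤ) ≤ S := by positivity
  obtain ⟨x, y, z, w, hx, hy, hz, hw, e1, e2⟩ := cauchy_nonneg a b (by omega) hb3
    (by nlinarith) (by linarith) (by nlinarith)
  refine ⟨x.toNat, y.toNat, z.toNat, w.toNat, ?_⟩
  zify
  rw [hexP_toNat x hx, hexP_toNat y hy, hexP_toNat z hz, hexP_toNat w hw]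
  linarith

theorem sum_hexagonal_1113_range :
    {n : ℕ | ∃ x₁ x₂ x₃ x₄ : ℕ,
        n = x₁ * (2 * x₁ - 1) + x₂ * (2 * x₂ - 1) + x₃ * (2 * x₃ - 1)
            + 3 * (x₄ * (2 * x₄ - 1))}
      = {n : ℕ | n ∉ ({14, 23, 41, 42, 83} : Set ℕ)} := by
  ext n
  have e : n ∉ ({14, 23, 41, 42, 83} : Set ℕ) ↔ n ∉ [14, 23, 41, 42, 83] := by simp
  change (∃ x₁ x₂ x₃ x₄ : ℕ, n = hexP x₁ + hexP x₂ + hexP x₃ + 3 * hexP x₄) ↔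
    n ∉ ({14, 23, 41, 42, 83} : Set ℕ)
  rw [e]
  constructor
  · rintro ⟨a, b, c, d, h⟩ hmem
    have hle : n ≤ 83 := by
      simp at hmem
      omega
    have := hex_exc a (hexP_lt (by omega)) b (hexP_lt (by omega)) c (hexP_lt (by omega)) d
      (hexP_lt (by omega))
    rw [← h] at this
    exact this hmem
  · intro h
    by_cases hn : n < 2750
    · exact hex_small n hn h
    · exact hex_large n (by omega)
end

section
/- Let m ≥ 3 be an integer. Then every integer N ≥ 1056m³ can be written as N = p_{m+2}(x₁) + p_{m+2}(x₂) + 2·p_{m+2}(x₃) + 4·p_{m+2}(x₄) for some nonnegative integers x₁, x₂, x₃, x₄. -/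
/-- Polygonal number of order `m+2`: `p_{m+2}(n) = (m·n² − (m−2)·n)/2 = m·n(n−1)/2 + n`. -/
def polygonal (m n : ℕ) : ℕ := m * (n * (n - 1)) / 2 + n


theorem center_mod (a t : ℤ) (ha : 0 < a) : ∃ k : ℤ, 2 * (t + k * a) ≤ a ∧ -a ≤ 2 * (t + k * a) := by
  refine ⟨-((2 * t + a) / (2 * a)), ?_⟩
  have h1 := Int.emod_add_mul_ediv (2 * t + a) (2 * a)
  have h2 := Int.emod_nonneg (2 * t + a) (show 2 * a ≠ 0 by omega)
  have h3 := Int.emod_lt_of_pos (2 * t + a) (show 0 < 2 * a by omega)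
  constructor <;> nlinarith

theorem binary_reduce (n : ℕ) : ∀ A B C D : ℤ, A ≤ n → 0 < A → 0 < D → A * C - B ^ 2 = D →
    ∃ α β γ δ : ℤ, α * δ - β * γ = 1 ∧ 0 < A * α ^ 2 + 2 * B * α * γ + C * γ ^ 2 ∧
      3 * (A * α ^ 2 + 2 * B * α * γ + C * γ ^ 2) ^ 2 ≤ 4 * D := by
  induction n with
  | zero => intro A B C D h1 h2; simp at h1; omega
  | succ n ih =>
    intro A B C D hn hA hD h
    by_cases hs : 3 * A ^ 2 ≤ 4 * D
    · exact ⟨1, 0, 0, 1, by norm_num, by simpa using hA, by simpa using hs⟩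
    · push Not at hs
      obtain ⟨k, hk1, hk2⟩ := center_mod A B hA
      set B' := B + k * A with hB
      set C' := A * k ^ 2 + 2 * B * k + C with hC
      have hd : C' * A - (-B') ^ 2 = D := by rw [hB, hC, ← h]; ring
      have hb : 4 * B' ^ 2 ≤ A ^ 2 := by nlinarith
      have hC0 : 0 < C' := by
        by_contra hcon
        nlinarith [sq_nonneg B']
      have hCA : C' < A := by
        by_contra hcon
        push Not at hcon
        nlinarith
      obtain ⟨α, β, γ, δ, e1, e2, e3⟩ := ih C' (-B') A D (by push_cast at hn; omega) hC0 hD hd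
      have key : A * (k * α - γ) ^ 2 + 2 * B * (k * α - γ) * α + C * α ^ 2
          = C' * α ^ 2 + 2 * (-B') * α * γ + A * γ ^ 2 := by
        rw [hB, hC]; ring
      refine ⟨k * α - γ, k * β - δ, α, β, ?_, ?_, ?_⟩
      · linarith
      · rw [key]; exact e2
      · rw [key]; exact e3

theorem binary_one (A B C : ℤ) (hA : 0 < A) (h : A * C - B ^ 2 = 1) (y z : ℤ) :
    ∃ p q : ℤ, A * y ^ 2 + 2 * B * y * z + C * z ^ 2 = p ^ 2 + q ^ 2 := by
  obtain ⟨α, β, γ, δ, e1, e2, e3⟩ := binary_reduce A.toNat A B C 1 (by omega) hA one_pos h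
  set g := A * α ^ 2 + 2 * B * α * γ + C * γ ^ 2 with hg
  have hg1 : g = 1 := by nlinarith
  set B' := A * α * β + B * (α * δ + β * γ) + C * γ * δ with hB'
  set C' := A * β ^ 2 + 2 * B * β * δ + C * δ ^ 2 with hC'
  have hd : g * C' - B' ^ 2 = 1 := by
    have : g * C' - B' ^ 2 = (A * C - B ^ 2) * (α * δ - β * γ) ^ 2 := by
      rw [hg, hB', hC']; ring
    rw [this, h, e1]; norm_num
  obtain ⟨y', hy'⟩ : ∃ y', y' = δ * y - β * z := ⟨_, rfl⟩
  obtain ⟨z', hz'⟩ : ∃ z', z' = -γ * y + α * z := ⟨_, rfl⟩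
  have hy : y = α * y' + β * z' := by rw [hy', hz']; linear_combination (-y) * e1
  have hz : z = γ * y' + δ * z' := by rw [hy', hz']; linear_combination (-z) * e1
  refine ⟨y' + B' * z', z', ?_⟩
  have : A * y ^ 2 + 2 * B * y * z + C * z ^ 2 = g * y' ^ 2 + 2 * B' * y' * z' + C' * z' ^ 2 := by
    rw [hg, hB', hC', hy, hz]; ring
  rw [this, hg1]
  rw [hg1] at hd
  linear_combination z' ^ 2 * hd

set_option maxHeartbeats 1000000 in
theorem ternary_one (n : ℕ) : ∀ a b c r s t : ℤ, a ≤ n → 0 < a → 0 < a * b - t ^ 2 →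
    a * b * c + 2 * r * s * t - a * r ^ 2 - b * s ^ 2 - c * t ^ 2 = 1 → ∀ x y z : ℤ,
    ∃ p q w : ℤ, a * x ^ 2 + b * y ^ 2 + c * z ^ 2 + 2 * r * y * z + 2 * s * x * z + 2 * t * x * y
      = p ^ 2 + q ^ 2 + w ^ 2 := by
  induction n with
  | zero => intro a b c r s t h1 h2; simp at h1; omega
  | succ n ih =>
    intro a b c r s t hn ha hab hdet x y z
    by_cases ha1 : a = 1
    · subst ha1
      obtain ⟨p, q, h⟩ := binary_one (b - t ^ 2) (r - s * t) (c - s ^ 2) (by linarith)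
        (by linear_combination hdet) y z
      exact ⟨x + t * y + s * z, p, q, by linear_combination h⟩
    · obtain ⟨α, β, γ, δ, e1, e2, e3⟩ := binary_reduce (a * b - t ^ 2).toNat (a * b - t ^ 2)
        (a * r - s * t) (a * c - s ^ 2) a (by omega) hab ha (by linear_combination a * hdet)
      obtain ⟨b', hb'⟩ : ∃ b', b' = b * α ^ 2 + 2 * r * α * γ + c * γ ^ 2 := ⟨_, rfl⟩
      obtain ⟨c', hc'⟩ : ∃ c', c' = b * β ^ 2 + 2 * r * β * δ + c * δ ^ 2 := ⟨_, rfl⟩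
      obtain ⟨r', hr'⟩ : ∃ r', r' = b * α * β + r * (α * δ + β * γ) + c * γ * δ := ⟨_, rfl⟩
      obtain ⟨t', ht'⟩ : ∃ t', t' = t * α + s * γ := ⟨_, rfl⟩
      obtain ⟨s', hs'⟩ : ∃ s', s' = t * β + s * δ := ⟨_, rfl⟩
      have hg : (a * b - t ^ 2) * α ^ 2 + 2 * (a * r - s * t) * α * γ + (a * c - s ^ 2) * γ ^ 2
          = a * b' - t' ^ 2 := by rw [hb', ht']; ring
      rw [hg] at e2 e3
      have hdet' : a * b' * c' + 2 * r' * s' * t' - a * r' ^ 2 - b' * s' ^ 2 - c' * t' ^ 2 = 1 := by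
        have : a * b' * c' + 2 * r' * s' * t' - a * r' ^ 2 - b' * s' ^ 2 - c' * t' ^ 2
          = (a * b * c + 2 * r * s * t - a * r ^ 2 - b * s ^ 2 - c * t ^ 2)
            * (α * δ - β * γ) ^ 2 := by
          rw [hb', hc', hr', ht', hs']; ring
        rw [this, hdet, e1]; norm_num
      obtain ⟨k, hk1, hk2⟩ := center_mod a t' ha
      obtain ⟨t'', ht''⟩ : ∃ t'', t'' = t' + k * a := ⟨_, rfl⟩
      obtain ⟨b'', hb''⟩ : ∃ b'', b'' = b' + 2 * k * t' + k ^ 2 * a := ⟨_, rfl⟩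
      obtain ⟨r'', hr''⟩ : ∃ r'', r'' = r' + k * s' := ⟨_, rfl⟩
      rw [← ht''] at hk1 hk2
      have hg2 : a * b' - t' ^ 2 = b'' * a - t'' ^ 2 := by rw [hb'', ht'']; ring
      rw [hg2] at e2 e3
      have hdet'' : b'' * a * c' + 2 * s' * r'' * t'' - b'' * s' ^ 2 - a * r'' ^ 2 - c' * t'' ^ 2
          = 1 := by
        rw [← hdet', hb'', hr'', ht'']; ring
      have ht2 : 4 * t'' ^ 2 ≤ a ^ 2 := by nlinarith
      have hb0 : 0 < b'' := by
        by_contra hcon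
        nlinarith [sq_nonneg t'']
      have hba : b'' < a := by
        by_contra hcon
        push Not at hcon
        have h1 : 3 * a ^ 2 ≤ 4 * (b'' * a - t'' ^ 2) := by nlinarith
        have h2 : (3 * a ^ 2) ^ 2 ≤ (4 * (b'' * a - t'' ^ 2)) ^ 2 := by
          apply pow_le_pow_left₀ (by positivity) h1
        have h3 : 27 * a ^ 4 ≤ 64 * a := by nlinarith
        have h4 : 2 ≤ a := by omega
        have h5 : 2 ^ 3 ≤ a ^ 3 := pow_le_pow_left₀ (by norm_num) h4 3
        have h6 := mul_le_mul_of_nonneg_left h5 ha.le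
        have h7 : a * a ^ 3 = a ^ 4 := by ring
        rw [h7] at h6
        linarith
      obtain ⟨y', hy'⟩ : ∃ y', y' = δ * y - β * z := ⟨_, rfl⟩
      obtain ⟨z', hz'⟩ : ∃ z', z' = -γ * y + α * z := ⟨_, rfl⟩
      have hy : y = α * y' + β * z' := by rw [hy', hz']; linear_combination (-y) * e1
      have hz : z = γ * y' + δ * z' := by rw [hy', hz']; linear_combination (-z) * e1
      obtain ⟨p, q, w, h⟩ := ih b'' a c' s' r'' t'' (by push_cast at hn; omega) hb0 e2 hdet''
        y' (x - k * y') z'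
      refine ⟨p, q, w, ?_⟩
      rw [← h, hb'', hr'', ht'', hb', hc', hr', ht', hs', hy, hz]; ring

theorem three_squares (n : ℕ) (hn : n % 4 = 2) : ∃ p q w : ℤ, (n : ℤ) = p ^ 2 + q ^ 2 + w ^ 2 := by
  have hcop : Nat.Coprime (n - 1) (4 * n) := by
    apply Nat.Coprime.mul_right
    · have : Nat.Coprime (n - 1) (2 ^ 2) := by
        apply Nat.Coprime.pow_right
        rw [Nat.coprime_two_right, Nat.odd_iff]; omega
      exact this
    · have := Nat.coprime_self_sub_left (show 1 ≤ n by omega)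
      rw [this]; exact Nat.coprime_one_left n
  have : NeZero (4 * n) := ⟨by omega⟩
  obtain ⟨P, hP, hprime, hmod⟩ := Nat.forall_exists_prime_gt_and_modEq n (show 4 * n ≠ 0 by omega) hcop
  obtain ⟨j, hj⟩ : ∃ j, P = n - 1 + 4 * n * j := by
    have h := (Nat.modEq_iff_dvd' (by omega)).1 hmod.symm
    obtain ⟨j, hj⟩ := h
    exact ⟨j, by omega⟩
  have : Fact P.Prime := ⟨hprime⟩
  have hPd : P + 1 = (4 * j + 1) * n := by
    have : (4 * j + 1) * n = 4 * n * j + n := by ring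
    omega
  have hP4 : P % 4 = 1 := by
    have : 4 * n * j = 4 * (n * j) := by ring
    omega
  have hleg : legendreSym P (-((4 * j + 1 : ℕ) : ℤ)) = 1 := by
    rw [jacobiSym.legendreSym.to_jacobiSym, neg_eq_neg_one_mul, jacobiSym.mul_left,
      jacobiSym.at_neg_one (Nat.odd_iff.2 (by omega)), ZMod.χ₄_nat_one_mod_four hP4,
      jacobiSym.quadratic_reciprocity_one_mod_four (by omega) (Nat.odd_iff.2 (by omega)), one_mul]
    have : ((P : ℕ) : ℤ) % ((4 * j + 1 : ℕ) : ℤ) = (-1) % ((4 * j + 1 : ℕ) : ℤ) := by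
      apply Int.ModEq.symm
      rw [Int.modEq_iff_dvd]
      refine ⟨n, ?_⟩
      have : ((P + 1 : ℕ) : ℤ) = ((4 * j + 1) * n : ℕ) := by rw [hPd]
      push_cast at this ⊢
      linarith
    rw [jacobiSym.mod_left' this, jacobiSym.at_neg_one (Nat.odd_iff.2 (by omega)),
      ZMod.χ₄_nat_one_mod_four (by omega)]
  have hne : ((-((4 * j + 1 : ℕ) : ℤ) : ℤ) : ZMod P) ≠ 0 := by
    intro h0
    rw [← legendreSym.eq_zero_iff] at h0
    omega
  obtain ⟨y, hy⟩ := (legendreSym.eq_one_iff P hne).1 hleg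
  obtain ⟨t, rfl⟩ := ZMod.intCast_surjective y
  have hdvd : (P : ℤ) ∣ t ^ 2 + ((4 * j + 1 : ℕ) : ℤ) := by
    rw [← ZMod.intCast_zmod_eq_zero_iff_dvd]
    push_cast at hy ⊢
    linear_combination -hy
  obtain ⟨a, ha⟩ := hdvd
  have hPpos : (0 : ℤ) < P := by exact_mod_cast hprime.pos
  have hPd' : (P : ℤ) + 1 = (4 * j + 1) * n := by exact_mod_cast hPd
  push_cast at ha
  have ha0 : 0 < a := by
    by_contra hcon
    have : (P : ℤ) * a ≤ 0 := by nlinarith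
    nlinarith [sq_nonneg t]
  obtain ⟨p, q, w, h⟩ := ternary_one a.toNat a P n 0 1 t (by omega) ha0
    (by nlinarith) (by linear_combination -hPd' - (n : ℤ) * ha) 0 0 1
  exact ⟨p, q, w, by linear_combination h⟩

theorem one_one_two (K : ℤ) (hK : 0 < K) (hodd : K % 2 = 1) :
    ∃ u v w : ℤ, K = u ^ 2 + v ^ 2 + 2 * w ^ 2 ∧ u % 2 = 1 ∧ v % 2 = 0 := by
  -- symmetric core
  have core : ∀ p q r : ℤ, 2 * K = p ^ 2 + q ^ 2 + r ^ 2 → p % 2 = 1 → q % 2 = 1 → r % 2 = 0 →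
      ∃ u v w : ℤ, K = u ^ 2 + v ^ 2 + 2 * w ^ 2 ∧ u % 2 = 1 ∧ v % 2 = 0 := by
    intro p q r h hp hq hr
    obtain ⟨w, rfl⟩ : ∃ w, r = 2 * w := ⟨r / 2, by omega⟩
    obtain ⟨u, hu⟩ : ∃ u, p = 2 * u - q := ⟨(p + q) / 2, by omega⟩
    obtain ⟨v, hv⟩ : ∃ v, q = u - v := ⟨u - q, by omega⟩
    have hp' : p = u + v := by omega
    have hK' : K = u ^ 2 + v ^ 2 + 2 * w ^ 2 := by
      subst hp'; subst hv; linarith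
    rcases Int.emod_two_eq_zero_or_one u with h0 | h0
    · exact ⟨v, u, w, by linarith, by omega, h0⟩
    · exact ⟨u, v, w, hK', h0, by omega⟩
  obtain ⟨p, q, r, h⟩ := three_squares (2 * K).toNat (by omega)
  have h : 2 * K = p ^ 2 + q ^ 2 + r ^ 2 := by rw [← h]; omega
  have sq : ∀ x : ℤ, (x % 2 = 0 ∧ x ^ 2 % 4 = 0) ∨ (x % 2 = 1 ∧ x ^ 2 % 4 = 1) := by
    intro x
    rcases Int.emod_two_eq_zero_or_one x with h0 | h0
    · obtain ⟨y, rfl⟩ : ∃ y, x = 2 * y := ⟨x / 2, by omega⟩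
      left; refine ⟨h0, ?_⟩; ring_nf; omega
    · obtain ⟨y, rfl⟩ : ∃ y, x = 2 * y + 1 := ⟨x / 2, by omega⟩
      right; refine ⟨h0, ?_⟩; ring_nf; omega
  rcases sq p with ⟨p1, p2⟩ | ⟨p1, p2⟩ <;> rcases sq q with ⟨q1, q2⟩ | ⟨q1, q2⟩ <;>
    rcases sq r with ⟨r1, r2⟩ | ⟨r1, r2⟩ <;> first | omega | skip
  · exact core q r p (by linarith) q1 r1 p1
  · exact core p r q (by linarith) p1 r1 q1
  · exact core p q r h p1 q1 r1

theorem int_rep_nonneg (a b x₁ x₂ x₃ x₄ : ℤ) (hb : 0 < b) (hab : 7 * a ≤ b ^ 2)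
    (h1 : x₁ + x₂ + 2 * x₃ + 4 * x₄ = b)
    (h2 : x₁ ^ 2 + x₂ ^ 2 + 2 * x₃ ^ 2 + 4 * x₄ ^ 2 = a) :
    0 ≤ x₁ ∧ 0 ≤ x₂ ∧ 0 ≤ x₃ ∧ 0 ≤ x₄ := by
  subst h1 h2
  refine ⟨?_, ?_, ?_, ?_⟩
  · by_contra hc
    push Not at hc
    have h := mul_pos hb (neg_pos.2 hc)
    nlinarith [sq_nonneg (x₂ - x₃), sq_nonneg (x₂ - x₄), sq_nonneg (x₃ - x₄), sq_nonneg x₁,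
      mul_pos (neg_pos.2 hc) (neg_pos.2 hc)]
  · by_contra hc
    push Not at hc
    have h := mul_pos hb (neg_pos.2 hc)
    nlinarith [sq_nonneg (x₁ - x₃), sq_nonneg (x₁ - x₄), sq_nonneg (x₃ - x₄), sq_nonneg x₂,
      mul_pos (neg_pos.2 hc) (neg_pos.2 hc)]
  · by_contra hc
    push Not at hc
    have h := mul_pos hb (neg_pos.2 hc)
    nlinarith [sq_nonneg (x₁ - x₂), sq_nonneg (x₁ - x₄), sq_nonneg (x₂ - x₄), sq_nonneg x₁,
      sq_nonneg x₂, sq_nonneg x₄, mul_pos (neg_pos.2 hc) (neg_pos.2 hc)]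
  · by_contra hc
    push Not at hc
    have h := mul_pos hb (neg_pos.2 hc)
    nlinarith [sq_nonneg (x₁ - x₂), sq_nonneg (x₁ - x₃), sq_nonneg (x₂ - x₃), sq_nonneg x₁,
      sq_nonneg x₂, sq_nonneg x₃, mul_pos (neg_pos.2 hc) (neg_pos.2 hc)]

theorem sq_emod_sixteen (x : ℤ) (hx : x % 2 = 1) :
    ((x % 8 = 1 ∨ x % 8 = 7) ∧ x ^ 2 % 16 = 1) ∨ ((x % 8 = 3 ∨ x % 8 = 5) ∧ x ^ 2 % 16 = 9) := by
  obtain ⟨k, r, rfl, hr⟩ : ∃ k r : ℤ, x = 8 * k + r ∧ (r = 1 ∨ r = 3 ∨ r = 5 ∨ r = 7) :=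
    ⟨x / 8, x % 8, by omega, by omega⟩
  rcases hr with rfl | rfl | rfl | rfl <;> ring_nf <;> omega

theorem sq_emod_eight (x : ℤ) : (x % 2 = 1 ∧ x ^ 2 % 8 = 1) ∨ (x % 4 = 0 ∧ x ^ 2 % 8 = 0)
    ∨ (x % 4 = 2 ∧ x ^ 2 % 8 = 4) := by
  obtain ⟨k, r, rfl, hr⟩ : ∃ k r : ℤ, x = 4 * k + r ∧ (r = 0 ∨ r = 1 ∨ r = 2 ∨ r = 3) :=
    ⟨x / 4, x % 4, by omega, by omega⟩
  rcases hr with rfl | rfl | rfl | rfl <;> ring_nf <;> omega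

def GoodPair (b c : ℤ) : Prop :=
  b % 2 = 1 ∨ b % 4 = 2 ∨ (b % 8 = 0 ∧ c % 2 = 1) ∨ (b % 8 = 4 ∧ c % 2 = 0) ∨
    (b % 8 = 0 ∧ c % 8 = 4)

theorem int_rep (b c : ℤ) (hg : GoodPair b c) (hab : b ^ 2 ≤ 8 * (2 * c + b)) :
    ∃ x₁ x₂ x₃ x₄ : ℤ, x₁ + x₂ + 2 * x₃ + 4 * x₄ = b ∧
      x₁ ^ 2 + x₂ ^ 2 + 2 * x₃ ^ 2 + 4 * x₄ ^ 2 = 2 * c + b := by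
  have build : ∀ x₁ x₂ x₃ x₄ y z w : ℤ, 8 * x₄ = b - y → 8 * x₃ = b + y - 2 * z →
      8 * x₁ = b + y + 2 * z + 4 * w → 8 * x₂ = b + y + 2 * z - 4 * w →
      8 * (2 * c + b) - b ^ 2 = y ^ 2 + 2 * z ^ 2 + 4 * w ^ 2 →
      ∃ x₁ x₂ x₃ x₄ : ℤ, x₁ + x₂ + 2 * x₃ + 4 * x₄ = b ∧
      x₁ ^ 2 + x₂ ^ 2 + 2 * x₃ ^ 2 + 4 * x₄ ^ 2 = 2 * c + b := by
    intro x₁ x₂ x₃ x₄ y z w h4 h3 h1 h2 h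
    refine ⟨x₁, x₂, x₃, x₄, by omega, ?_⟩
    obtain rfl : y = b - 8 * x₄ := by omega
    obtain rfl : z = b - 4 * x₄ - 4 * x₃ := by omega
    obtain rfl : w = x₁ - x₂ := by omega
    obtain rfl : b = x₁ + x₂ + 2 * x₃ + 4 * x₄ := by omega
    nlinarith
  have sgn : ∀ x : ℤ, (-x) ^ 2 = x ^ 2 := fun x => by ring
  rcases hg with hb | hb | hb | hb | hb
  · -- b odd
    have hb2 := sq_emod_sixteen b hb
    obtain ⟨u, v, z, hK, hu, hv⟩ := one_one_two (8 * (2 * c + b) - b ^ 2) (by omega) (by omega)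
    obtain ⟨w, rfl⟩ : ∃ w, v = 2 * w := ⟨v / 2, by omega⟩
    have hK : 8 * (2 * c + b) - b ^ 2 = u ^ 2 + 2 * z ^ 2 + 4 * w ^ 2 := by linarith
    have hu2 := sq_emod_sixteen u hu
    have hz2 := sq_emod_eight z
    have hw2 := sq_emod_eight w
    have hzo : z % 2 = 1 := by omega
    have hwo : w % 2 = 1 := by omega
    obtain ⟨y, hy, hyb⟩ : ∃ y : ℤ, y ^ 2 = u ^ 2 ∧ (b - y) % 8 = 0 := by
      by_cases h : (b - u) % 8 = 0
      · exact ⟨u, rfl, h⟩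
      · exact ⟨-u, sgn u, by omega⟩
    obtain ⟨t, ht, htb⟩ : ∃ t : ℤ, t ^ 2 = z ^ 2 ∧ (b + y - 2 * t) % 8 = 0 := by
      by_cases h : (b + y - 2 * z) % 8 = 0
      · exact ⟨z, rfl, h⟩
      · exact ⟨-z, sgn z, by omega⟩
    have hto : t % 2 = 1 := by have := sq_emod_eight t; omega
    rw [← hy, ← ht] at hK
    exact build ((b + y + 2 * t + 4 * w) / 8) ((b + y + 2 * t - 4 * w) / 8) ((b + y - 2 * t) / 8)
      ((b - y) / 8) y t w (by omega) (by omega) (by omega) (by omega) hK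
  · obtain ⟨β, rfl⟩ : ∃ β, b = 2 * β := ⟨b / 2, by omega⟩
    have hb2 := sq_emod_eight β
    have hK0 : 8 * (2 * c + 2 * β) - (2 * β) ^ 2 = 4 * (2 * (2 * c + 2 * β) - β ^ 2) := by ring
    obtain ⟨u, w, z, hK, hu, hw⟩ := one_one_two (2 * (2 * c + 2 * β) - β ^ 2) (by omega) (by omega)
    have hu2 := sq_emod_eight u
    have hz2 := sq_emod_eight z
    have hw2 := sq_emod_eight w
    have hzo : z % 2 = 1 := by omega
    obtain ⟨y, hy, hyb⟩ : ∃ y : ℤ, y ^ 2 = u ^ 2 ∧ (β - y) % 4 = 0 := by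
      by_cases h : (β - u) % 4 = 0
      · exact ⟨u, rfl, h⟩
      · exact ⟨-u, sgn u, by omega⟩
    rw [← hy] at hK
    exact build ((β + y + 2 * z + 2 * w) / 4) ((β + y + 2 * z - 2 * w) / 4) ((β + y - 2 * z) / 4)
      ((β - y) / 4) (2 * y) (2 * z) w (by omega) (by omega) (by omega) (by omega)
      (by rw [hK0, hK]; ring)
  pick_goal 3
  · obtain ⟨e, rfl⟩ : ∃ e, b = 8 * e := ⟨b / 8, by omega⟩
    obtain ⟨f, rfl⟩ : ∃ f, c = 4 * f := ⟨c / 4, by omega⟩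
    have hb2 := sq_emod_eight e
    have hK0 : 8 * (2 * (4 * f) + 8 * e) - (8 * e) ^ 2 = 64 * (f + e - e ^ 2) := by ring
    obtain ⟨u, v, w, hK, hu, hv⟩ := one_one_two (f + e - e ^ 2) (by omega) (by omega)
    exact build (e + u + 2 * w + 2 * v) (e + u + 2 * w - 2 * v) (e + u - 2 * w) (e - u)
      (8 * u) (8 * w) (4 * v) (by ring) (by ring) (by ring) (by ring) (by rw [hK0, hK]; ring)
  all_goals
    obtain ⟨β, rfl⟩ : ∃ β, b = 4 * β := ⟨b / 4, by omega⟩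
    have hb2 := sq_emod_eight β
    have hK0 : 8 * (2 * c + 4 * β) - (4 * β) ^ 2 = 16 * (c + 2 * β - β ^ 2) := by ring
    obtain ⟨u, v, z, hK, hu, hv⟩ := one_one_two (c + 2 * β - β ^ 2) (by omega) (by omega)
    obtain ⟨y, w, hyw, hy⟩ : ∃ y w : ℤ, y ^ 2 + w ^ 2 = u ^ 2 + v ^ 2 ∧ (β - y) % 2 = 0 := by
      by_cases h : (β - u) % 2 = 0
      · exact ⟨u, v, rfl, h⟩
      · exact ⟨v, u, by ring, by omega⟩
    rw [← hyw] at hK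
    exact build ((β + y + 2 * z + 2 * w) / 2) ((β + y + 2 * z - 2 * w) / 2) ((β + y - 2 * z) / 2)
      ((β - y) / 2) (4 * y) (4 * z) (2 * w) (by omega) (by omega) (by omega) (by omega)
      (by rw [hK0, hK]; ring)

theorem exists_good (m b c : ℤ) : ∃ j : ℤ, 0 ≤ j ∧ j ≤ 7 ∧ GoodPair (b + j * m) (c - j) := by
  unfold GoodPair
  by_cases h1 : b % 2 = 1
  · exact ⟨0, by omega, by omega, by omega⟩
  by_cases h2 : m % 2 = 1
  · exact ⟨1, by omega, by omega, by omega⟩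
  by_cases h3 : b % 4 = 2
  · exact ⟨0, by omega, by omega, by omega⟩
  by_cases h4 : m % 4 = 2
  · exact ⟨1, by omega, by omega, by omega⟩
  by_cases h5 : m % 8 = 0
  · by_cases h6 : (b % 8 = 0 ∧ c % 2 = 1) ∨ (b % 8 = 4 ∧ c % 2 = 0)
    · exact ⟨0, by omega, by omega, by omega⟩
    · exact ⟨1, by omega, by omega, by omega⟩
  by_cases h6 : (b % 8 = 0 ∧ c % 2 = 1) ∨ (b % 8 = 4 ∧ c % 2 = 0)
  · exact ⟨0, by omega, by omega, by omega⟩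
  obtain ⟨k, rfl⟩ : ∃ k, m = 8 * k + 4 := ⟨m / 8, by omega⟩
  refine ⟨(c - 4) % 8, by omega, by omega, ?_⟩
  obtain ⟨j, hj⟩ : ∃ j, j = (c - 4) % 8 := ⟨_, rfl⟩
  rw [← hj]
  have : b + j * (8 * k + 4) = b + 8 * (j * k) + 4 * j := by ring
  rw [this]
  omega

theorem exists_window (m N : ℤ) (hm : 3 ≤ m) (hN : 1056 * m ^ 3 ≤ N) :
    ∃ B : ℤ, 0 < B ∧ ∀ b c : ℤ, B ≤ b → b < B + 8 * m → N = m * c + b →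
      7 * (2 * c + b) ≤ b ^ 2 ∧ b ^ 2 ≤ 8 * (2 * c + b) := by
  have hm3 : 0 < m ^ 3 := by positivity
  have hex : ∃ n : ℕ, 14 * N + 7 * (m - 2) * (n : ℤ) ≤ m * (n : ℤ) ^ 2 := by
    refine ⟨(14 * N + 7).toNat, ?_⟩
    have : ((14 * N + 7).toNat : ℤ) = 14 * N + 7 := by omega
    rw [this]
    nlinarith [mul_pos (show 0 < m by omega) (show 0 < N by omega)]
  classical
  obtain ⟨B, hB, hmin⟩ : ∃ n : ℕ, 14 * N + 7 * (m - 2) * (n : ℤ) ≤ m * (n : ℤ) ^ 2 ∧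
      ∀ k < n, ¬ (14 * N + 7 * (m - 2) * (k : ℤ) ≤ m * (k : ℤ) ^ 2) :=
    ⟨Nat.find hex, Nat.find_spec hex, fun k hk => Nat.find_min hex hk⟩
  have hB121 : 121 * m ≤ B := by
    by_contra hcon
    push Not at hcon
    have h0 : (0 : ℤ) ≤ B := by positivity
    have h1 : (B : ℤ) ^ 2 ≤ (121 * m) ^ 2 := pow_le_pow_left₀ h0 hcon.le 2
    have h2 : m * (B : ℤ) ^ 2 ≤ m * (121 * m) ^ 2 := mul_le_mul_of_nonneg_left h1 (by omega)
    have h3 : 0 ≤ (m - 2) * (B : ℤ) := mul_nonneg (by omega) h0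
    nlinarith
  have hu := hmin (B - 1) (by omega)
  obtain ⟨u, hu'⟩ : ∃ u : ℤ, u = B - 1 := ⟨_, rfl⟩
  rw [show ((B - 1 : ℕ) : ℤ) = u by omega] at hu
  push Not at hu
  have hBu : (B : ℤ) = u + 1 := by omega
  rw [hBu] at hB hB121
  have htop : m * (u + 8 * m) ^ 2 ≤ 16 * N + 8 * (m - 2) * (u + 8 * m) := by
    have hmm : 0 < m * (m - 2) := mul_pos (by omega) (by omega)
    by_cases hc : u ≤ 119 * m
    · have : m ^ 2 * u ≤ m ^ 2 * (119 * m) := mul_le_mul_of_nonneg_left hc (by positivity)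
      have : 0 ≤ (m - 2) * u := mul_nonneg (by omega) (by omega)
      nlinarith
    · push Not at hc
      have : 0 < m * ((u - 119 * m) * (u + 7 * m)) :=
        mul_pos (by omega) (mul_pos (by omega) (by omega))
      have : 0 < m ^ 2 * (u - 119 * m) := mul_pos (by positivity) (by omega)
      nlinarith
  refine ⟨B, by omega, ?_⟩
  rw [hBu]
  intro b c hb1 hb2 hNb
  have hmpos : 0 < m := by omega
  have e1 : m * (7 * (2 * c + b)) = 14 * N + 7 * (m - 2) * b := by rw [hNb]; ring
  have e2 : m * (8 * (2 * c + b)) = 16 * N + 8 * (m - 2) * b := by rw [hNb]; ring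
  constructor
  · apply le_of_mul_le_mul_left _ hmpos
    rw [e1]
    have : 0 ≤ (b - (u + 1)) * (m * (b + (u + 1)) - 7 * (m - 2)) :=
      mul_nonneg (by omega) (by nlinarith)
    nlinarith
  · apply le_of_mul_le_mul_left _ hmpos
    rw [e2]
    have : 0 ≤ (u + 8 * m - b) * (m * (u + 8 * m + b) - 8 * (m - 2)) :=
      mul_nonneg (by omega) (by nlinarith)
    nlinarith

theorem two_mul_polygonal (m n : ℕ) :
    2 * (polygonal m n : ℤ) = m * ((n : ℤ) ^ 2 - n) + 2 * n := by
  unfold polygonal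
  have h : 2 ∣ m * (n * (n - 1)) := Dvd.dvd.mul_left (Nat.even_mul_pred_self n).two_dvd m
  obtain ⟨k, hk⟩ := h
  have hk' : (m : ℤ) * ((n : ℤ) ^ 2 - n) = 2 * k := by
    rcases Nat.eq_zero_or_pos n with rfl | hn
    · simp at hk ⊢; omega
    · have : ((m * (n * (n - 1)) : ℕ) : ℤ) = ((2 * k : ℕ) : ℤ) := by rw [hk]
      push_cast [Nat.cast_sub hn] at this
      linear_combination this
  rw [hk, Nat.mul_div_cancel_left _ (by norm_num), hk']
  push_cast; ring

theorem sum_polygonal_1124 (m : ℕ) (hm : 3 ≤ m)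
    (N : ℕ) (hN : 1056 * m ^ 3 ≤ N) :
    ∃ x₁ x₂ x₃ x₄ : ℕ,
      N = polygonal m x₁ + polygonal m x₂ + 2 * polygonal m x₃ + 4 * polygonal m x₄ := by
  obtain ⟨B, hB0, hB⟩ := exists_window m N (by exact_mod_cast hm) (by exact_mod_cast hN)
  have hmpos : (0 : ℤ) < m := by omega
  -- a first candidate in the window, congruent to `N` modulo `m`
  have h1 := Int.emod_add_mul_ediv ((N : ℤ) - B) m
  have h2 := Int.emod_nonneg ((N : ℤ) - B) hmpos.ne'
  have h3 := Int.emod_lt_of_pos ((N : ℤ) - B) hmpos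
  obtain ⟨j, hj0, hj7, hg⟩ := exists_good m (B + ((N : ℤ) - B) % m) (((N : ℤ) - B) / m)
  obtain ⟨b, hb⟩ : ∃ b, b = B + ((N : ℤ) - B) % m + j * m := ⟨_, rfl⟩
  obtain ⟨c, hc⟩ : ∃ c, c = ((N : ℤ) - B) / m - j := ⟨_, rfl⟩
  rw [← hb, ← hc] at hg
  have hNb : (N : ℤ) = m * c + b := by rw [hb, hc]; linear_combination -h1
  have hj0' : 0 ≤ j * (m : ℤ) := mul_nonneg hj0 hmpos.le
  have hj7' : j * (m : ℤ) ≤ 7 * m := mul_le_mul_of_nonneg_right hj7 hmpos.le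
  obtain ⟨hl, hu⟩ := hB b c (by omega) (by omega) hNb
  obtain ⟨x₁, x₂, x₃, x₄, e1, e2⟩ := int_rep b c hg hu
  obtain ⟨p1, p2, p3, p4⟩ := int_rep_nonneg (2 * c + b) b x₁ x₂ x₃ x₄ (by omega) hl e1 e2
  lift x₁ to ℕ using p1
  lift x₂ to ℕ using p2
  lift x₃ to ℕ using p3
  lift x₄ to ℕ using p4
  refine ⟨x₁, x₂, x₃, x₄, ?_⟩
  have key : 2 * (N : ℤ) = 2 * (polygonal m x₁ + polygonal m x₂ + 2 * polygonal m x₃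
      + 4 * polygonal m x₄) := by
    have q1 := two_mul_polygonal m x₁
    have q2 := two_mul_polygonal m x₂
    have q3 := two_mul_polygonal m x₃
    have q4 := two_mul_polygonal m x₄
    linear_combination 2 * hNb - q1 - q2 - 2 * q3 - 4 * q4 + (m - 2) * e1 - m * e2
  zify
  linarith
end

section
/- Let a and b be positive integers with a ≡ b (mod 2), b² < 6a and 5a < b² + 2b + 6. Suppose that a is odd or a ≡ 4 (mod 8), and that 3 divides a or 3 does not divide b. Then there exist nonnegative integers s, t, u, v such that a = s² + t² + 2u² + 2v² and b = s + t + 2u + 2v. -/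
theorem three_sq_zero (x y z : ℤ) (h : x ^ 2 + y ^ 2 + z ^ 2 = 0) : x = 0 ∧ y = 0 ∧ z = 0 := by
  have hx := sq_nonneg x
  have hy := sq_nonneg y
  have hz := sq_nonneg z
  exact ⟨pow_eq_zero_iff two_ne_zero |>.mp (by linarith),
    pow_eq_zero_iff two_ne_zero |>.mp (by linarith),
    pow_eq_zero_iff two_ne_zero |>.mp (by linarith)⟩

/-- Davenport-Cassels descent for sums of three squares. -/
theorem three_sq_descent (N : ℤ) : ∀ n : ℕ, ∀ T A B C : ℤ, 0 < T → T.toNat ≤ n →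
    N * T ^ 2 = A ^ 2 + B ^ 2 + C ^ 2 → ∃ x y z : ℤ, N = x ^ 2 + y ^ 2 + z ^ 2 := by
  intro n
  induction n with
  | zero => intro T A B C hT hn; omega
  | succ n ih =>
    intro T A B C hT hn h
    have key : ∀ X : ℤ, ∃ x : ℤ, 4 * (x * T - X) ^ 2 ≤ T ^ 2 := by
      intro X
      refine ⟨(2 * X + T) / (2 * T), ?_⟩
      have h1 := Int.emod_nonneg (2 * X + T) (show (2 * T) ≠ 0 by omega)
      have h2 := Int.emod_lt_of_pos (2 * X + T) (show 0 < 2 * T by omega)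
      have h3 := Int.emod_add_mul_ediv (2 * X + T) (2 * T)
      generalize (2 * X + T) / (2 * T) = q at *
      generalize (2 * X + T) % (2 * T) = r at *
      have h4 : 2 * (q * T - X) = T - r := by linarith
      have h5 : 4 * (q * T - X) ^ 2 = (T - r) ^ 2 := by rw [← h4]; ring
      rw [h5]
      nlinarith
    obtain ⟨a, ha⟩ := key A
    obtain ⟨b, hb⟩ := key B
    obtain ⟨c, hc⟩ := key C
    set k := a ^ 2 + b ^ 2 + c ^ 2 - N with hk
    set m := 2 * (N * T - (A * a + B * b + C * c)) with hm
    have e1 : T * (k * T + m) = (a * T - A) ^ 2 + (b * T - B) ^ 2 + (c * T - C) ^ 2 := by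
      rw [hk, hm]; linear_combination h
    have e2 : N * (k * T + m) ^ 2
        = (k * A + m * a) ^ 2 + (k * B + m * b) ^ 2 + (k * C + m * c) ^ 2 := by
      have hd : 2 * (A * a + B * b + C * c) = 2 * N * T - m := by rw [hm]; ring
      have hs : a ^ 2 + b ^ 2 + c ^ 2 = k + N := by rw [hk]; ring
      linear_combination k ^ 2 * h - k * m * hd - m ^ 2 * hs
    by_cases hz : k * T + m = 0
    · rw [hz, mul_zero] at e1
      obtain ⟨z1, z2, z3⟩ := three_sq_zero _ _ _ e1.symm
      refine ⟨a, b, c, ?_⟩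
      have hA : A = a * T := by linarith
      have hB : B = b * T := by linarith
      have hC : C = c * T := by linarith
      have hT2 : T ^ 2 ≠ 0 := by positivity
      apply mul_right_cancel₀ hT2
      rw [h, hA, hB, hC]; ring
    · have hnn : 0 ≤ T * (k * T + m) := by rw [e1]; positivity
      have hpos : 0 < k * T + m :=
        lt_of_le_of_ne (nonneg_of_mul_nonneg_right hnn hT) (Ne.symm hz)
      have hlt : k * T + m < T := by
        rw [pow_two T] at ha hb hc
        by_contra hcon
        push Not at hcon
        have g1 : T * T ≤ T * (k * T + m) := mul_le_mul_of_nonneg_left hcon hT.le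
        have g2 : 0 < T * T := mul_pos hT hT
        rw [e1] at g1
        linarith
      exact ih _ _ _ _ hpos (by omega) e2

/-- The pigeonhole step. -/
theorem small_solution (N p : ℕ) (hN : 0 < N) (hp : p.Prime) (r : ℤ) :
    ∃ z t w : ℤ, (z ≠ 0 ∨ t ≠ 0 ∨ w ≠ 0) ∧ (N : ℤ) ∣ z - w ∧ (p : ℤ) ∣ z - r * t ∧
      z ^ 2 ≤ N * p ∧ t ^ 2 ≤ p ∧ w ^ 2 ≤ N := by
  have : NeZero N := ⟨hN.ne'⟩
  have : NeZero p := ⟨hp.ne_zero⟩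
  let f : Fin (Nat.sqrt (N * p) + 1) × Fin (Nat.sqrt p + 1) × Fin (Nat.sqrt N + 1) →
      ZMod N × ZMod p := fun x =>
    (((x.1.1 : ℤ) - (x.2.2.1 : ℤ) : ℤ), ((x.1.1 : ℤ) - r * (x.2.1.1 : ℤ) : ℤ))
  have hcard : Fintype.card (ZMod N × ZMod p) <
      Fintype.card (Fin (Nat.sqrt (N * p) + 1) × Fin (Nat.sqrt p + 1) × Fin (Nat.sqrt N + 1)) := by
    simp only [Fintype.card_prod, ZMod.card, Fintype.card_fin]
    have h1 := Nat.lt_succ_sqrt (N * p)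
    have h2 := Nat.lt_succ_sqrt p
    have h3 := Nat.lt_succ_sqrt N
    simp only [Nat.succ_eq_add_one] at h1 h2 h3
    generalize Nat.sqrt (N * p) + 1 = x at *
    generalize Nat.sqrt p + 1 = y at *
    generalize Nat.sqrt N + 1 = z at *
    have h4 : N * p < (y * z) * (y * z) := by
      calc N * p < (z * z) * (y * y) := Nat.mul_lt_mul'' h3 h2
        _ = _ := by ring
    have h5 : (N * p) * (N * p) < (x * (y * z)) * (x * (y * z)) := by
      calc (N * p) * (N * p) < (x * x) * ((y * z) * (y * z)) := Nat.mul_lt_mul'' h1 h4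
        _ = _ := by ring
    exact Nat.mul_self_lt_mul_self_iff.mp h5
  obtain ⟨⟨z1, t1, w1⟩, ⟨z2, t2, w2⟩, hne, heq⟩ := Fintype.exists_ne_map_eq_of_card_lt f hcard
  have hsq : ∀ n : ℕ, ∀ i j : Fin (Nat.sqrt n + 1), ((i.1 : ℤ) - j.1) ^ 2 ≤ n := by
    intro n i j
    have h1 : (Nat.sqrt n : ℤ) * Nat.sqrt n ≤ n := by exact_mod_cast Nat.sqrt_le n
    have hi : (i.1 : ℤ) ≤ Nat.sqrt n := by have := i.2; omega
    have hj : (j.1 : ℤ) ≤ Nat.sqrt n := by have := j.2; omega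
    have hi0 : (0 : ℤ) ≤ i.1 := by positivity
    have hj0 : (0 : ℤ) ≤ j.1 := by positivity
    nlinarith
  simp only [f, Prod.mk.injEq] at heq
  obtain ⟨q1, q2⟩ := heq
  rw [ZMod.intCast_eq_intCast_iff_dvd_sub] at q1 q2
  refine ⟨(z2.1 : ℤ) - z1.1, (t2.1 : ℤ) - t1.1, (w2.1 : ℤ) - w1.1, ?_, ?_, ?_, ?_, ?_, ?_⟩
  · by_contra hcon
    push Not at hcon
    obtain ⟨c1, c2, c3⟩ := hcon
    apply hne
    simp only [Prod.mk.injEq]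
    refine ⟨Fin.ext ?_, Fin.ext ?_, Fin.ext ?_⟩ <;> omega
  · convert q1 using 1; ring
  · convert q2 using 1; ring
  · exact_mod_cast hsq _ z2 z1
  · exact hsq _ t2 t1
  · exact hsq _ w2 w1

theorem three_sq_of_prime (N p : ℕ) (hN : 0 < N) (hp : p.Prime) (hp4 : p % 4 = 1)
    (hNp : N ∣ p + 1) (hqr : IsSquare ((N : ℤ) : ZMod p)) :
    ∃ x y z : ℤ, (N : ℤ) = x ^ 2 + y ^ 2 + z ^ 2 := by
  have : Fact p.Prime := ⟨hp⟩
  obtain ⟨g, h, hgh⟩ := Nat.Prime.sq_add_sq (p := p) (by omega)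
  have hgh' : (g : ℤ) ^ 2 + (h : ℤ) ^ 2 = p := by exact_mod_cast hgh
  obtain ⟨r', hr'⟩ := hqr
  obtain ⟨r, rfl⟩ := ZMod.intCast_surjective r'
  have hr : (p : ℤ) ∣ r * r - N := by
    rw [← ZMod.intCast_eq_intCast_iff_dvd_sub]
    rw [hr']; push_cast; rfl
  obtain ⟨z, t, w, hne, d1, d2, b1, b2, b3⟩ := small_solution N p hN hp r
  have hNp' : (N : ℤ) ∣ p + 1 := by exact_mod_cast hNp
  have hcop : IsCoprime (N : ℤ) (p : ℤ) := by
    obtain ⟨c, hc⟩ := hNp'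
    exact ⟨c, -1, by linarith⟩
  have dN : (N : ℤ) ∣ z ^ 2 + p * w ^ 2 - N * t ^ 2 := by
    have : z ^ 2 + p * w ^ 2 - N * t ^ 2 = (z - w) * (z + w) + (p + 1) * w ^ 2 - N * t ^ 2 := by ring
    rw [this]
    exact dvd_sub (dvd_add (d1.mul_right _) (hNp'.mul_right _)) (dvd_mul_right _ _)
  have dp : (p : ℤ) ∣ z ^ 2 + p * w ^ 2 - N * t ^ 2 := by
    have : z ^ 2 + p * w ^ 2 - N * t ^ 2
        = (z - r * t) * (z + r * t) + p * w ^ 2 + (r * r - N) * t ^ 2 := by ring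
    rw [this]
    exact dvd_add (dvd_add (d2.mul_right _) (dvd_mul_right _ _)) (hr.mul_right _)
  obtain ⟨V, hV⟩ := hcop.mul_dvd dN dp
  have hN0 : (0 : ℤ) < N := by exact_mod_cast hN
  have hp0 : (0 : ℤ) < p := by exact_mod_cast hp.pos
  have hns : ∀ x : ℤ, x ^ 2 ≠ p := by
    intro x hx
    have : Prime (p : ℤ) := Nat.prime_iff_prime_int.mp hp
    exact this.irreducible.not_isSquare ⟨x, by rw [← hx]; ring⟩
  have ht : t ^ 2 < p := lt_of_le_of_ne b2 (hns t)
  have hNp0 : (0 : ℤ) < N * p := by positivity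
  have hVlow : -1 < V := by
    by_contra hcon
    have : (N * p : ℤ) * V ≤ N * p * (-1) := mul_le_mul_of_nonneg_left (by omega) hNp0.le
    have h2 : (N : ℤ) * t ^ 2 < N * p := mul_lt_mul_of_pos_left ht hN0
    nlinarith [sq_nonneg z, sq_nonneg w]
  have hVhi : V < 2 := by
    by_contra hcon
    have h1 : (N * p : ℤ) * 2 ≤ N * p * V := mul_le_mul_of_nonneg_left (by omega) hNp0.le
    have h2 : (p : ℤ) * w ^ 2 ≤ p * N := mul_le_mul_of_nonneg_left b3 hp0.le
    have h3 : 0 ≤ (N : ℤ) * t ^ 2 := by positivity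
    have h4 : z ^ 2 = N * p := by linarith
    have h5 : (p : ℤ) * w ^ 2 = p * N := by linarith
    have h6 : w ^ 2 = N := mul_left_cancel₀ hp0.ne' h5
    have h7 : w ^ 2 ∣ z ^ 2 := ⟨p, by rw [h4, h6]⟩
    obtain ⟨c, hc⟩ := (Int.pow_dvd_pow_iff two_ne_zero).mp h7
    apply hns c
    apply mul_left_cancel₀ hN0.ne'
    rw [← h4, hc, ← h6]; ring
  have hVc : V = 0 ∨ V = 1 := by omega
  rcases hVc with rfl | rfl
  · have ht0 : t ≠ 0 := by
      rintro rfl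
      have e : z ^ 2 + p * w ^ 2 = 0 := by linarith
      have hw : 0 ≤ (p : ℤ) * w ^ 2 := by positivity
      have hz : z ^ 2 = 0 := by nlinarith [sq_nonneg z]
      have hw' : (p : ℤ) * w ^ 2 = 0 := by linarith
      have hz0 : z = 0 := by simpa using hz
      have hw0 : w = 0 := by
        rcases mul_eq_zero.mp hw' with h | h
        · omega
        · simpa using h
      simp_all
    refine three_sq_descent N _ |t| z (g * w) (h * w) (abs_pos.mpr ht0) le_rfl ?_
    rw [sq_abs]
    linear_combination -hV - w ^ 2 * hgh'
  · refine three_sq_descent N _ (t ^ 2 + p) (z * t - p * w) (g * (z + w * t)) (h * (z + w * t))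
      (by positivity) le_rfl ?_
    linear_combination -(t ^ 2 + p) * hV - (z + w * t) ^ 2 * hgh'

theorem three_sq (N : ℕ) (hN : N % 4 = 1 ∨ N % 4 = 2) :
    ∃ x y z : ℤ, (N : ℤ) = x ^ 2 + y ^ 2 + z ^ 2 := by
  have hpos : 0 < N := by omega
  rcases hN with h | h
  · have hc : Nat.Coprime (2 * N - 1) (4 * N) := by
      have h1 : Nat.Coprime (2 * N - 1) (2 * N) := by
        have := Nat.coprime_self_add_right (m := 2 * N - 1) (n := 1)
        rw [show 2 * N - 1 + 1 = 2 * N by omega] at this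
        rw [this]; exact Nat.coprime_one_right _
      have h2 : Nat.Coprime (2 * N - 1) 2 := by
        rw [Nat.coprime_two_right, Nat.odd_iff]; omega
      have := h2.mul_right h1
      rwa [← mul_assoc] at this
    obtain ⟨p, hpgt, hp, hmod⟩ := Nat.forall_exists_prime_gt_and_modEq (2 * N) (by omega) hc
    have hd : 4 * N ∣ p - (2 * N - 1) := (Nat.modEq_iff_dvd' (by omega)).mp hmod.symm
    obtain ⟨c, hc⟩ := hd
    have hpe : p + 1 = N * (4 * c + 2) := by
      have : 4 * N * c = 4 * (N * c) := by ring
      have h2 : N * (4 * c + 2) = 4 * (N * c) + 2 * N := by ring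
      omega
    have hp4 : p % 4 = 1 := by
      have h2 : N * (4 * c + 2) = 4 * (N * c) + 2 * N := by ring
      omega
    have : Fact p.Prime := ⟨hp⟩
    refine three_sq_of_prime N p hpos hp hp4 ⟨_, hpe⟩ ?_
    apply ZMod.isSquare_of_jacobiSym_eq_one
    have hodd : Odd N := by rw [Nat.odd_iff]; omega
    rw [jacobiSym.quadratic_reciprocity_one_mod_four' hodd hp4]
    rw [jacobiSym.mod_left' (a₂ := -1), jacobiSym.at_neg_one hodd, ZMod.χ₄_nat_one_mod_four h]
    apply Int.ModEq.symm
    rw [Int.modEq_iff_dvd]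
    refine ⟨4 * c + 2, ?_⟩
    have hpe' : (p : ℤ) + 1 = N * (4 * c + 2) := by exact_mod_cast hpe
    linear_combination hpe'
  · obtain ⟨M, rfl⟩ : ∃ M, N = 2 * M := ⟨N / 2, by omega⟩
    have hc : Nat.Coprime (2 * M - 1) (8 * M) := by
      have h1 : Nat.Coprime (2 * M - 1) (2 * M) := by
        have := Nat.coprime_self_add_right (m := 2 * M - 1) (n := 1)
        rw [show 2 * M - 1 + 1 = 2 * M by omega] at this
        rw [this]; exact Nat.coprime_one_right _
      have h2 : Nat.Coprime (2 * M - 1) 2 := by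
        rw [Nat.coprime_two_right, Nat.odd_iff]; omega
      have := (h2.mul_right h2).mul_right h1
      rwa [show 2 * 2 * (2 * M) = 8 * M by ring] at this
    obtain ⟨p, hpgt, hp, hmod⟩ := Nat.forall_exists_prime_gt_and_modEq (2 * M) (by omega) hc
    have hd : 8 * M ∣ p - (2 * M - 1) := (Nat.modEq_iff_dvd' (by omega)).mp hmod.symm
    obtain ⟨c, hc⟩ := hd
    have hpe : p + 1 = 8 * (M * c) + 2 * M := by
      have : 8 * M * c = 8 * (M * c) := by ring
      omega
    have hp4 : p % 4 = 1 := by omega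
    have : Fact p.Prime := ⟨hp⟩
    refine three_sq_of_prime (2 * M) p hpos hp hp4 ⟨4 * c + 1, by rw [hpe]; ring⟩ ?_
    apply ZMod.isSquare_of_jacobiSym_eq_one
    have hodd : Odd M := by rw [Nat.odd_iff]; omega
    have hpodd : Odd p := by rw [Nat.odd_iff]; omega
    push_cast
    rw [jacobiSym.mul_left, jacobiSym.quadratic_reciprocity_one_mod_four' hodd hp4,
      jacobiSym.mod_left' (a₁ := (p : ℤ)) (a₂ := -1), jacobiSym.at_neg_one hodd,
      jacobiSym.at_two hpodd, ZMod.χ₈_nat_eq_if_mod_eight, ZMod.χ₄_nat_eq_if_mod_four]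
    · have hM : M % 4 = 1 ∨ M % 4 = 3 := by omega
      rcases hM with hM | hM
      · have : p % 8 = 1 := by omega
        simp [this, hM, show p % 2 = 1 by omega, show M % 2 = 1 by omega]
      · have : p % 8 = 5 := by omega
        simp [this, hM, show p % 2 = 1 by omega, show M % 2 = 1 by omega]
    · apply Int.ModEq.symm
      rw [Int.modEq_iff_dvd]
      refine ⟨8 * c + 2, ?_⟩
      have : (p : ℤ) + 1 = 8 * (M * c) + 2 * M := by exact_mod_cast hpe
      linear_combination this

/-- From three squares to the form `2x² + 3y² + 6z²`. -/
theorem form_236 (N α β γ : ℤ) (hN : N = α ^ 2 + β ^ 2 + γ ^ 2) (h3 : N % 3 ≠ 1) :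
    ∃ x y z : ℤ, N = 2 * x ^ 2 + 3 * y ^ 2 + 6 * z ^ 2 := by
  -- choose signs so that the sum is divisible by three
  have signs : ∃ α β γ : ℤ, N = α ^ 2 + β ^ 2 + γ ^ 2 ∧ (α + β + γ) % 3 = 0 := by
    have cube : ∀ x : ℤ, x % 3 = 0 ∧ x ^ 2 % 3 = 0 ∨ x % 3 = 1 ∧ x ^ 2 % 3 = 1 ∨
        x % 3 = 2 ∧ x ^ 2 % 3 = 1 := by
      intro x
      have : x % 3 = 0 ∨ x % 3 = 1 ∨ x % 3 = 2 := by omega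
      rcases this with h | h | h <;> simp [pow_two, Int.mul_emod, h]
    have ca := cube α
    have cb := cube β
    have cc := cube γ
    have : (α + β + γ) % 3 = 0 ∨ (-α + β + γ) % 3 = 0 ∨ (α - β + γ) % 3 = 0 ∨
        (α + β - γ) % 3 = 0 := by omega
    rcases this with h | h | h | h
    · exact ⟨α, β, γ, hN, h⟩
    · exact ⟨-α, β, γ, by rw [hN]; ring, h⟩
    · exact ⟨α, -β, γ, by rw [hN]; ring, by rw [← h]; ring_nf⟩
    · exact ⟨α, β, -γ, by rw [hN]; ring, by rw [← h]; ring_nf⟩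
  have main : ∀ α β γ : ℤ, N = α ^ 2 + β ^ 2 + γ ^ 2 → (α + β + γ) % 3 = 0 → (α - β) % 2 = 0 →
      ∃ x y z : ℤ, N = 2 * x ^ 2 + 3 * y ^ 2 + 6 * z ^ 2 := by
    intro α β γ hN h h2
    obtain ⟨x, hx⟩ : ∃ x, α - β = 2 * x := ⟨(α - β) / 2, by omega⟩
    obtain ⟨y, hy⟩ : ∃ y, α + β + γ = 3 * y := ⟨(α + β + γ) / 3, by omega⟩
    obtain ⟨z, hz⟩ : ∃ z, α + β - 2 * γ = 6 * z := ⟨(α + β - 2 * γ) / 6, by omega⟩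
    refine ⟨x, y, z, ?_⟩
    have e1 : α = x + y + z := by linarith
    have e2 : β = -x + y + z := by linarith
    have e3 : γ = y - 2 * z := by linarith
    rw [hN, e1, e2, e3]; ring
  obtain ⟨α, β, γ, hN, h⟩ := signs
  have : (α - β) % 2 = 0 ∨ (β - γ) % 2 = 0 ∨ (γ - α) % 2 = 0 := by omega
  rcases this with h2 | h2 | h2
  · exact main α β γ hN h h2
  · exact main β γ α (by rw [hN]; ring) (by rw [← h]; ring_nf) h2
  · exact main γ α β (by rw [hN]; ring) (by rw [← h]; ring_nf) h2

theorem sq_mod_four (x : ℤ) : x % 2 = 0 ∧ x ^ 2 % 4 = 0 ∨ x % 2 = 1 ∧ x ^ 2 % 4 = 1 := by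
  have : x % 2 = 0 ∨ x % 2 = 1 := by omega
  rcases this with h | h
  · obtain ⟨k, rfl⟩ : ∃ k, x = 2 * k := ⟨x / 2, by omega⟩
    left
    have : (2 * k) ^ 2 = 4 * k ^ 2 := by ring
    omega
  · obtain ⟨k, rfl⟩ : ∃ k, x = 2 * k + 1 := ⟨x / 2, by omega⟩
    right
    have : (2 * k + 1) ^ 2 = 4 * (k ^ 2 + k) + 1 := by ring
    omega

theorem int_rep_s16 (a b : ℤ) (hpar : a % 2 = b % 2) (h1 : b ^ 2 < 6 * a)
    (h3 : a % 2 = 1 ∨ a % 8 = 4) :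
    ∃ s t u v : ℤ, a = s ^ 2 + t ^ 2 + 2 * u ^ 2 + 2 * v ^ 2 ∧ b = s + t + 2 * u + 2 * v := by
  have three : ∃ x y z : ℤ, 6 * a - b ^ 2 = x ^ 2 + y ^ 2 + z ^ 2 := by
    rcases h3 with h | h
    · obtain ⟨N, hN⟩ := Int.eq_ofNat_of_zero_le (show 0 ≤ 6 * a - b ^ 2 by omega)
      have := sq_mod_four b
      rw [hN]
      exact three_sq N (by omega)
    · obtain ⟨c, rfl⟩ : ∃ c, b = 2 * c := ⟨b / 2, by omega⟩
      obtain ⟨d, rfl⟩ : ∃ d, a = 4 * d := ⟨a / 4, by omega⟩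
      have e : (2 * c) ^ 2 = 4 * c ^ 2 := by ring
      obtain ⟨N, hN⟩ := Int.eq_ofNat_of_zero_le (show 0 ≤ 6 * d - c ^ 2 by omega)
      have := sq_mod_four c
      obtain ⟨x, y, z, hxyz⟩ := three_sq N (by omega)
      refine ⟨2 * x, 2 * y, 2 * z, ?_⟩
      have hN' : 6 * d - c ^ 2 = x ^ 2 + y ^ 2 + z ^ 2 := by rw [← hxyz]; exact hN
      linear_combination 4 * hN'
  obtain ⟨α, β, γ, hN⟩ := three
  have sq3 : ∀ x : ℤ, x % 3 = 0 ∧ x ^ 2 % 3 = 0 ∨ x % 3 = 1 ∧ x ^ 2 % 3 = 1 ∨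
      x % 3 = 2 ∧ x ^ 2 % 3 = 1 := by
    intro x
    have : x % 3 = 0 ∨ x % 3 = 1 ∨ x % 3 = 2 := by omega
    rcases this with h | h | h <;> simp [pow_two, Int.mul_emod, h]
  have sb := sq3 b
  obtain ⟨x, q, w, hf⟩ := form_236 _ α β γ hN (by omega)
  have hx : ∃ r : ℤ, 6 * a - b ^ 2 = 2 * (3 * r - b) ^ 2 + 3 * q ^ 2 + 6 * w ^ 2 := by
    have sx := sq3 x
    have : (x + b) % 3 = 0 ∨ (-x + b) % 3 = 0 := by omega
    rcases this with h | h
    · refine ⟨(x + b) / 3, ?_⟩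
      rw [show 3 * ((x + b) / 3) - b = x by omega]; exact hf
    · refine ⟨(-x + b) / 3, ?_⟩
      rw [show 3 * ((-x + b) / 3) - b = -x by omega, neg_sq]; exact hf
  obtain ⟨r, hr⟩ := hx
  have hr2 : 2 * a = (b - 2 * r) ^ 2 + q ^ 2 + 2 * r ^ 2 + 2 * w ^ 2 := by
    have : 3 * (2 * a) = 3 * ((b - 2 * r) ^ 2 + q ^ 2 + 2 * r ^ 2 + 2 * w ^ 2) := by
      linear_combination hr
    omega
  have eb : (b - 2 * r) ^ 2 = b ^ 2 - 4 * (b * r) + 4 * r ^ 2 := by ring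
  have mb := sq_mod_four b
  have mq := sq_mod_four q
  have mr := sq_mod_four r
  have mw := sq_mod_four w
  have hqb : q % 2 = b % 2 := by omega
  have hrw : r % 2 = w % 2 := by omega
  obtain ⟨s, hs⟩ : ∃ s, b - 2 * r + q = 2 * s := ⟨(b - 2 * r + q) / 2, by omega⟩
  obtain ⟨u, hu⟩ : ∃ u, r + w = 2 * u := ⟨(r + w) / 2, by omega⟩
  have hq : q = 2 * s - b + 2 * r := by linarith
  have hw : w = 2 * u - r := by linarith
  refine ⟨s, b - 2 * r - s, u, r - u, ?_, by ring⟩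
  rw [hq, hw] at hr2
  have : 2 * a = 2 * (s ^ 2 + (b - 2 * r - s) ^ 2 + 2 * u ^ 2 + 2 * (r - u) ^ 2) := by
    rw [hr2]; ring
  omega

theorem nonneg_one (a b s t u v : ℤ) (hb : 0 < b) (h2 : 5 * a < b ^ 2 + 2 * b + 6)
    (e1 : a = s ^ 2 + t ^ 2 + 2 * u ^ 2 + 2 * v ^ 2) (e2 : b = s + t + 2 * u + 2 * v) : 0 ≤ s := by
  by_contra hs
  have key : 5 * a = (b - s) ^ 2 + 5 * s ^ 2 + 2 * (t - u) ^ 2 + 2 * (t - v) ^ 2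
      + 4 * (u - v) ^ 2 := by
    rw [e1, e2]; ring
  have h3 : b ^ 2 + 2 * b + 6 ≤ (b - s) ^ 2 + 5 * s ^ 2 := by nlinarith
  nlinarith [sq_nonneg (t - u), sq_nonneg (t - v), sq_nonneg (u - v)]

theorem nonneg_two (a b s t u v : ℤ) (hb : 0 < b) (h2 : 5 * a < b ^ 2 + 2 * b + 6)
    (e1 : a = s ^ 2 + t ^ 2 + 2 * u ^ 2 + 2 * v ^ 2) (e2 : b = s + t + 2 * u + 2 * v) : 0 ≤ u := by
  by_contra hs
  have key : 4 * a = (b - 2 * u) ^ 2 + 8 * u ^ 2 + (s - t) ^ 2 * 1 + 2 * (s - v) ^ 2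
      + 2 * (t - v) ^ 2 := by
    rw [e1, e2]; ring
  have h3 : b ^ 2 + 4 * b + 12 ≤ (b - 2 * u) ^ 2 + 8 * u ^ 2 := by nlinarith
  nlinarith [sq_nonneg (s - t), sq_nonneg (s - v), sq_nonneg (t - v)]

theorem lemma_1122_rep (a b : ℕ) (ha : 0 < a) (hb : 0 < b)
    (hpar : a % 2 = b % 2)
    (h1 : b ^ 2 < 6 * a) (h2 : 5 * a < b ^ 2 + 2 * b + 6)
    (h3 : Odd a ∨ a % 8 = 4) (h4 : 3 ∣ a ∨ ¬ 3 ∣ b) :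
    ∃ s t u v : ℕ,
      a = s ^ 2 + t ^ 2 + 2 * u ^ 2 + 2 * v ^ 2 ∧ b = s + t + 2 * u + 2 * v := by
  rw [Nat.odd_iff] at h3
  have h2' : 5 * (a : ℤ) < (b : ℤ) ^ 2 + 2 * b + 6 := by exact_mod_cast h2
  have hb' : (0 : ℤ) < b := by exact_mod_cast hb
  obtain ⟨s, t, u, v, e1, e2⟩ := int_rep_s16 a b (by omega) (by exact_mod_cast h1) (by omega)
  have hs := nonneg_one a b s t u v hb' h2' e1 e2
  have ht := nonneg_one a b t s u v hb' h2' (by rw [e1]; ring) (by rw [e2]; ring)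
  have hu := nonneg_two a b s t u v hb' h2' e1 e2
  have hv := nonneg_two a b s t v u hb' h2' (by rw [e1]; ring) (by rw [e2]; ring)
  lift s to ℕ using hs
  lift t to ℕ using ht
  lift u to ℕ using hu
  lift v to ℕ using hv
  exact ⟨s, t, u, v, by exact_mod_cast e1, by exact_mod_cast e2⟩
end
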